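/- arXiv:0711.4880 — 6 statements merged into one kernel-verified Lean document; each statement's English description precedes it below -/
import Mathlib

section
/- Let A be a commutative ring, Q ⊆ I ideals of A, and let {F_n}_{n≥0} be a family of ideals of A such that F_0 = A, I·F_n ⊆ F_{n+1} for all n ≥ 0, and I^{k+1} ⊆ Q·F_k + 𝔞·F_{k+1} for some integer k ≥ 0 and some ideal 𝔞 of A. Suppose that for every n ≥ 0 the A-module F_n/(Q·F_{n-1} + I^n) is generated by v_n elements, and that v_n = 0 for all sufficiently large n. Set v = Σ_{n≥0} v_n. Then I^{v+k+1} = Q·I^{v+k} + 𝔞·I^{v+k+1}. -/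
theorem mul_mem_colon_mul_pow {A : Type*} [CommRing A] {Q I : Ideal A} {m n : ℕ} {x y : A}
    (hx : x ∈ (Q * I ^ m).colon (I : Set A)) (hy : y ∈ I ^ n) :
    x * y ∈ (Q * I ^ (m + n)).colon (I : Set A) := by
  rw [Submodule.mem_colon] at hx ⊢
  intro z hz
  have := Ideal.mul_mem_mul (hx z hz) hy
  rw [pow_add, ← mul_assoc]
  convert this using 1
  simp only [smul_eq_mul]
  ring

theorem pow_succ_le_colon_mul_pow {A : Type*} [CommRing A] {Q I : Ideal A} (hQI : Q ≤ I) (n : ℕ) :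
    Q ^ (n + 1) ≤ (Q * I ^ (n + 1)).colon (I : Set A) := by
  intro x hx
  rw [Submodule.mem_colon]
  intro z hz
  have h : Q ^ (n + 1) * I ≤ Q * I ^ (n + 1) := by
    rw [pow_succ', pow_succ, mul_assoc]
    exact Ideal.mul_mono_right (Ideal.mul_mono_left (Ideal.pow_right_mono hQI n))
  exact h (Ideal.mul_mem_mul hx hz)

/-- The coefficients of a product of elements of the Rees algebra of `I` which are, up to
multiples of `Q`, polynomials of degree at most one. -/
theorem coeff_prod_mem_colon {A ι : Type*} [CommRing A] {Q I : Ideal A} (hQI : Q ≤ I)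
    (f : ι → Polynomial A) (b : ι → A) (hf : ∀ i, f i ∈ reesAlgebra I)
    (hf2 : ∀ i n, 2 ≤ n → (f i).coeff n ∈ (Q * I ^ n).colon (I : Set A))
    (hb : ∀ i, b i ∈ I) (hfb : ∀ i, (f i).coeff 1 - b i ∈ Q) (s : Finset ι) :
    (∀ n, s.card < n → (∏ i ∈ s, f i).coeff n ∈ (Q * I ^ n).colon (I : Set A)) ∧
      (∏ i ∈ s, f i).coeff s.card - ∏ i ∈ s, b i ∈ (Q * I ^ s.card).colon (I : Set A) := by
  classical
  induction s using Finset.induction_on with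
  | empty =>
    refine ⟨fun n hn => ?_, ?_⟩
    · rw [Finset.card_empty] at hn
      rw [Finset.prod_empty, Polynomial.coeff_one, if_neg hn.ne']
      exact zero_mem _
    · simp
  | insert j s hj ih =>
    obtain ⟨ih1, ih2⟩ := ih
    have hf' := (mem_reesAlgebra_iff I _).mp (hf j)
    have hg' := (mem_reesAlgebra_iff I _).mp
      (Subalgebra.prod_mem (reesAlgebra I) (t := s) fun i _ => hf i)
    have key : ∀ n m, 2 ≤ n ∨ s.card < m →
        (f j).coeff n * (∏ i ∈ s, f i).coeff m ∈ (Q * I ^ (n + m)).colon (I : Set A) := by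
      rintro n m (h | h)
      · exact mul_mem_colon_mul_pow (hf2 j n h) (hg' m)
      · rw [mul_comm ((f j).coeff n), add_comm n]
        exact mul_mem_colon_mul_pow (ih1 m h) (hf' n)
    rw [Finset.prod_insert hj, Finset.prod_insert hj, Finset.card_insert_of_notMem hj]
    refine ⟨fun n hn => ?_, ?_⟩
    · rw [Polynomial.coeff_mul]
      refine sum_mem fun p hp => ?_
      rw [Finset.HasAntidiagonal.mem_antidiagonal] at hp
      rw [← hp]
      exact key _ _ (by omega)
    · have h1 : (1, s.card) ∈ Finset.HasAntidiagonal.antidiagonal (s.card + 1) := by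
        rw [Finset.HasAntidiagonal.mem_antidiagonal, add_comm]
      rw [Polynomial.coeff_mul, ← Finset.add_sum_erase _ _ h1, add_sub_right_comm]
      refine add_mem ?_ (sum_mem fun p hp => ?_)
      · have e : (f j).coeff 1 * (∏ i ∈ s, f i).coeff s.card - b j * ∏ i ∈ s, b i
            = ((f j).coeff 1 - b j) * (∏ i ∈ s, f i).coeff s.card
              + ((∏ i ∈ s, f i).coeff s.card - ∏ i ∈ s, b i) * b j := by ring
        have hbj : b j ∈ I ^ 1 := by simpa using hb j
        have hfbj : (f j).coeff 1 - b j ∈ (Q * I ^ 1).colon (I : Set A) :=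
          pow_succ_le_colon_mul_pow hQI 0 (by simpa using hfb j)
        have h2 := mul_mem_colon_mul_pow hfbj (hg' s.card)
        rw [add_comm 1] at h2
        rw [e]
        exact add_mem h2 (mul_mem_colon_mul_pow ih2 hbj)
      · rw [Finset.mem_erase, Finset.HasAntidiagonal.mem_antidiagonal, Ne, Prod.ext_iff] at hp
        obtain ⟨hp1, hp2⟩ := hp
        rw [← hp2]
        refine key _ _ ?_
        dsimp only at hp1
        omega

theorem reesAlgebra_mono {A : Type*} [CommRing A] {Q I : Ideal A} (hQI : Q ≤ I) :
    reesAlgebra Q ≤ reesAlgebra I :=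
  fun _ hf n => Ideal.pow_right_mono hQI n (hf n)

theorem det_mem_of_forall_mem {A B ι : Type*} [CommRing A] [CommRing B] [Algebra A B]
    [Fintype ι] [DecidableEq ι] (S : Subalgebra A B) (M : Matrix ι ι B) (hM : ∀ i j, M i j ∈ S) :
    M.det ∈ S := by
  rw [Matrix.det_apply]
  exact sum_mem fun σ _ => by
    rw [Units.smul_def]
    exact zsmul_mem (prod_mem fun i _ => hM _ _) _

theorem adjugate_mem_of_forall_mem {A B ι : Type*} [CommRing A] [CommRing B] [Algebra A B]
    [Fintype ι] [DecidableEq ι] (S : Subalgebra A B) (M : Matrix ι ι B) (hM : ∀ i j, M i j ∈ S)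
    (i j : ι) : M.adjugate i j ∈ S := by
  rw [Matrix.adjugate_apply]
  refine det_mem_of_forall_mem S _ fun k l => ?_
  rw [Matrix.updateRow_apply]
  split_ifs
  · rw [Pi.single_apply]
    split_ifs
    exacts [one_mem _, zero_mem _]
  · exact hM _ _

/-- Modulo the Rees algebra of `I`, the homogeneous elements with coefficients in `F n` are
combinations over the Rees algebra of `Q` of the given generators. -/
theorem exists_monomial_eq_sum_add {A ι : Type*} [CommRing A] [Fintype ι] {Q I : Ideal A}
    (hQI : Q ≤ I) (F : ℕ → Ideal A) (d : ι → ℕ) (x : ι → A)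
    (hF : ∀ n, F (n + 1) ≤ Q * F n + I ^ (n + 1) + Ideal.span {y | ∃ i, d i = n + 1 ∧ x i = y})
    (n : ℕ) (y : A) (hy : y ∈ F n) :
    ∃ c : ι → Polynomial A, (∀ i, c i ∈ reesAlgebra Q) ∧ ∃ r ∈ reesAlgebra I,
      Polynomial.monomial n y = ∑ i, c i * Polynomial.monomial (d i) (x i) + r := by
  classical
  have hadd : ∀ p q : Polynomial A,
      (∃ c : ι → Polynomial A, (∀ i, c i ∈ reesAlgebra Q) ∧ ∃ r ∈ reesAlgebra I,
        p = ∑ i, c i * Polynomial.monomial (d i) (x i) + r) →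
      (∃ c : ι → Polynomial A, (∀ i, c i ∈ reesAlgebra Q) ∧ ∃ r ∈ reesAlgebra I,
        q = ∑ i, c i * Polynomial.monomial (d i) (x i) + r) →
      ∃ c : ι → Polynomial A, (∀ i, c i ∈ reesAlgebra Q) ∧ ∃ r ∈ reesAlgebra I,
        p + q = ∑ i, c i * Polynomial.monomial (d i) (x i) + r := by
    rintro _ _ ⟨c, hc, r, hr, rfl⟩ ⟨c', hc', r', hr', rfl⟩
    refine ⟨c + c', fun i => add_mem (hc i) (hc' i), r + r', add_mem hr hr', ?_⟩
    simp only [Pi.add_apply, add_mul, Finset.sum_add_distrib]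
    ring
  have hmul : ∀ t p : Polynomial A, t ∈ reesAlgebra Q →
      (∃ c : ι → Polynomial A, (∀ i, c i ∈ reesAlgebra Q) ∧ ∃ r ∈ reesAlgebra I,
        p = ∑ i, c i * Polynomial.monomial (d i) (x i) + r) →
      ∃ c : ι → Polynomial A, (∀ i, c i ∈ reesAlgebra Q) ∧ ∃ r ∈ reesAlgebra I,
        t * p = ∑ i, c i * Polynomial.monomial (d i) (x i) + r := by
    rintro t _ ht ⟨c, hc, r, hr, rfl⟩
    refine ⟨fun i => t * c i, fun i => mul_mem ht (hc i), t * r,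
      mul_mem (reesAlgebra_mono hQI ht) hr, ?_⟩
    simp only [mul_add, Finset.mul_sum, mul_assoc]
  have hrees : ∀ m, ∀ z ∈ I ^ m, ∃ c : ι → Polynomial A, (∀ i, c i ∈ reesAlgebra Q) ∧
      ∃ r ∈ reesAlgebra I,
        Polynomial.monomial m z = ∑ i, c i * Polynomial.monomial (d i) (x i) + r :=
    fun m z hz => ⟨0, fun _ => zero_mem _, _, reesAlgebra.monomial_mem.mpr hz, by simp⟩
  induction n generalizing y with
  | zero => exact hrees 0 y (by simp)
  | succ n ih =>
    obtain ⟨y', hy', y₃, hy₃, rfl⟩ := Submodule.mem_sup.mp (hF n hy)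
    obtain ⟨y₁, hy₁, y₂, hy₂, rfl⟩ := Submodule.mem_sup.mp hy'
    rw [map_add, map_add]
    refine hadd _ _ (hadd _ _ ?_ (hrees _ _ hy₂)) ?_
    · refine Submodule.mul_induction_on hy₁ (fun q hq z hz => ?_) fun z w hz hw => ?_
      · rw [add_comm n 1, ← Polynomial.monomial_mul_monomial]
        exact hmul _ _ (reesAlgebra.monomial_mem.mpr (by simpa using hq)) (ih z hz)
      · rw [map_add]
        exact hadd _ _ hz hw
    · refine Submodule.span_induction ?_ ?_ ?_ ?_ hy₃
      · rintro _ ⟨i, hi, rfl⟩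
        refine ⟨Pi.single i 1, fun j => ?_, 0, zero_mem _, ?_⟩
        · rw [Pi.single_apply]
          split_ifs
          exacts [one_mem _, zero_mem _]
        · simp [Pi.single_apply, hi]
      · rw [map_zero]
        exact ⟨0, fun _ => zero_mem _, 0, zero_mem _, by simp⟩
      · intro z w _ _ hz hw
        rw [map_add]
        exact hadd _ _ hz hw
      · intro a z _ hz
        rw [smul_eq_mul, ← Polynomial.C_mul_monomial]
        exact hmul _ _ (Subalgebra.algebraMap_mem _ a) hz

/-- The determinant trick: a product of `Fintype.card ι` elements of `I` agrees, up to an element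
multiplying `I` into `Q * I ^ Fintype.card ι`, with an element multiplying each `F n` into
`I ^ (Fintype.card ι + n)`. -/
theorem exists_prod_sub_mem_colon {A ι : Type*} [CommRing A] [Fintype ι] {Q I : Ideal A}
    (hQI : Q ≤ I) (F : ℕ → Ideal A) (hFI : ∀ n, I * F n ≤ F (n + 1))
    (d : ι → ℕ) (x : ι → A) (hx : ∀ i, x i ∈ F (d i))
    (hF : ∀ n, F (n + 1) ≤ Q * F n + I ^ (n + 1) + Ideal.span {y | ∃ i, d i = n + 1 ∧ x i = y})
    (a : ι → A) (ha : ∀ i, a i ∈ I) :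
    ∃ δ : A, δ - ∏ i, a i ∈ (Q * I ^ Fintype.card ι).colon (I : Set A) ∧
      ∀ n, ∀ y ∈ F n, δ * y ∈ I ^ (Fintype.card ι + n) := by
  classical
  have hrep := exists_monomial_eq_sum_add hQI F d x hF
  choose T hT r hr hTr using fun i =>
    hrep (d i + 1) (a i * x i) (hFI _ (Ideal.mul_mem_mul (ha i) (hx i)))
  let D : Matrix ι ι (Polynomial A) :=
    Matrix.diagonal (fun i => Polynomial.monomial 1 (a i)) - Matrix.of T
  let y : ι → Polynomial A := fun i => Polynomial.monomial (d i) (x i)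
  have hdiag : ∀ i j, Matrix.diagonal (fun i => Polynomial.monomial 1 (a i)) i j
      = Polynomial.monomial 1 (Matrix.diagonal a i j) := by
    intro i j
    simp only [Matrix.diagonal_apply]
    split_ifs <;> simp
  have haI : ∀ i j, Matrix.diagonal a i j ∈ I := by
    intro i j
    rw [Matrix.diagonal_apply]
    split_ifs
    exacts [ha i, zero_mem _]
  have hDij : ∀ i j, D i j = Polynomial.monomial 1 (Matrix.diagonal a i j) - T i j := by
    intro i j
    rw [← hdiag]
    rfl
  have hD : ∀ i j, D i j ∈ reesAlgebra I := by
    intro i j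
    rw [hDij]
    exact sub_mem (reesAlgebra.monomial_mem.mpr (by simpa using haI i j))
      (reesAlgebra_mono hQI (hT i j))
  have hDy : D.mulVec y = r := by
    funext i
    have h := hTr i
    rw [add_comm (d i) 1, ← Polynomial.monomial_mul_monomial] at h
    rw [Matrix.sub_mulVec, Pi.sub_apply, Matrix.mulVec_diagonal, h]
    exact add_sub_cancel_left _ _
  have hdety : ∀ i, D.det * y i ∈ reesAlgebra I := by
    intro i
    have h : D.adjugate.mulVec r = D.det • y := by
      rw [← hDy, Matrix.mulVec_mulVec, Matrix.adjugate_mul, Matrix.smul_mulVec,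
        Matrix.one_mulVec]
    rw [← smul_eq_mul, ← Pi.smul_apply, ← h]
    exact sum_mem fun j _ => mul_mem (adjugate_mem_of_forall_mem _ _ hD i j) (hr j)
  refine ⟨D.det.coeff (Fintype.card ι), ?_, fun n z hz => ?_⟩
  · have hprod : ∏ i, a i = (Matrix.diagonal a).det := by rw [Matrix.det_diagonal]
    rw [hprod, Matrix.det_apply, Matrix.det_apply, Polynomial.finsetSum_coeff,
      ← Finset.sum_sub_distrib]
    refine sum_mem fun σ _ => ?_
    rw [Units.smul_def, Units.smul_def, Polynomial.coeff_smul, ← smul_sub]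
    refine zsmul_mem ?_ _
    refine (coeff_prod_mem_colon hQI (fun i => D (σ i) i) (fun i => Matrix.diagonal a (σ i) i)
      (fun i => hD _ _) (fun i n hn => ?_) (fun i => haI _ _) (fun i => ?_) Finset.univ).2
    · obtain ⟨m, rfl⟩ := Nat.exists_eq_add_of_le' hn
      rw [hDij, Polynomial.coeff_sub, Polynomial.coeff_monomial, if_neg (by omega), zero_sub]
      exact neg_mem (pow_succ_le_colon_mul_pow hQI _ (hT _ _ _))
    · rw [hDij, Polynomial.coeff_sub, Polynomial.coeff_monomial, if_pos rfl, sub_sub_cancel_left]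
      exact neg_mem (by simpa using hT (σ i) i 1)
  · obtain ⟨c, hc, s, hs, hcs⟩ := hrep n z hz
    have h : D.det * Polynomial.monomial n z ∈ reesAlgebra I := by
      rw [hcs, mul_add, Finset.mul_sum]
      refine add_mem (sum_mem fun i _ => ?_) (mul_mem (det_mem_of_forall_mem _ _ hD) hs)
      rw [mul_left_comm]
      exact mul_mem (reesAlgebra_mono hQI (hc i)) (hdety i)
    simpa only [Polynomial.coeff_mul_monomial] using h (Fintype.card ι + n)

open scoped Pointwise in
theorem pow_card_add_eq_of_generators {A ι : Type*} [CommRing A] [Fintype ι] {Q I : Ideal A}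
    (𝔞 : Ideal A) (hQI : Q ≤ I) (F : ℕ → Ideal A) (hFI : ∀ n, I * F n ≤ F (n + 1))
    (d : ι → ℕ) (x : ι → A) (hx : ∀ i, x i ∈ F (d i))
    (hF : ∀ n, F (n + 1) ≤ Q * F n + I ^ (n + 1) + Ideal.span {y | ∃ i, d i = n + 1 ∧ x i = y})
    (k : ℕ) (hk : I ^ (k + 1) ≤ Q * F k + 𝔞 * F (k + 1)) :
    I ^ (Fintype.card ι + k + 1)
      = Q * I ^ (Fintype.card ι + k) + 𝔞 * I ^ (Fintype.card ι + k + 1) := by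
  set w := Fintype.card ι with hw
  refine le_antisymm ?_ (sup_le ?_ Ideal.mul_le_right)
  · have hsplit : I ^ (w + k + 1) = I ^ w * I ^ (k + 1) := by rw [add_assoc, pow_add]
    refine hsplit.trans_le (Ideal.mul_le.mpr ?_)
    intro p hp z hz
    have hpow : I ^ w = Ideal.span (∏ _i : ι, (I : Set A)) := by
      rw [← Ideal.prod_span]
      simp [hw]
    rw [hpow] at hp
    refine Submodule.span_induction (p := fun p _ => p * z ∈ Q * I ^ (w + k)
      + 𝔞 * I ^ (w + k + 1)) ?_ (by simp) ?_ ?_ hp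
    · intro p hp
      obtain ⟨a, ha, rfl⟩ := (Set.mem_fintype_prod _ _).mp hp
      obtain ⟨δ, hδ, hδF⟩ := exists_prod_sub_mem_colon hQI F hFI d x hx hF a ha
      have h1 : (δ - ∏ i, a i) * z ∈ Q * I ^ (w + k) := by
        rw [pow_succ'] at hz
        refine Submodule.mul_induction_on hz (fun b hb c hc => ?_) fun b c hb hc => ?_
        · rw [← mul_assoc, pow_add, ← mul_assoc]
          exact Ideal.mul_mem_mul (Submodule.mem_colon.mp hδ b hb) hc
        · rw [mul_add]
          exact add_mem hb hc
      have h2 : ∀ (J : Ideal A) (n : ℕ), ∀ b ∈ J * F n, δ * b ∈ J * I ^ (w + n) := by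
        intro J n b hb
        refine Submodule.mul_induction_on hb (fun b hb c hc => ?_) fun b c hb hc => ?_
        · rw [mul_left_comm]
          exact Ideal.mul_mem_mul hb (hδF n c hc)
        · rw [mul_add]
          exact add_mem hb hc
      obtain ⟨b, hb, c, hc, rfl⟩ := Submodule.mem_sup.mp (hk hz)
      have e : (∏ i, a i) * (b + c)
          = (δ * b - (δ - ∏ i, a i) * (b + c)) + δ * c := by ring
      rw [e]
      exact Submodule.add_mem_sup (sub_mem (h2 Q k b hb) h1) (h2 𝔞 (k + 1) c hc)
    · intro p q _ _ hp hq
      rw [add_mul]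
      exact add_mem hp hq
    · intro b p _ hp
      rw [smul_eq_mul, mul_assoc]
      exact Ideal.mul_mem_left _ _ hp
  · rw [pow_succ']
    exact Ideal.mul_mono_left hQI


/-- **Theorem 1.1.**  Let `A` be a commutative ring, `Q ⊆ I` ideals of `A`, and
`{F n}` a family of ideals with `F 0 = A`, `I·F n ⊆ F (n+1)`, and
`I^(k+1) ⊆ Q·F k + 𝔞·F (k+1)` for some `k ≥ 0` and ideal `𝔞`.  If each quotient
`F n / (Q·F (n-1) + I^n)` is generated by `v n` elements (expressed by the existence
of a finite set `s` of cardinality `v n` with `F n = Q·F (n-1) + I^n + span s`;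
for `n = 0` the convention `Q·F (-1) = 0` makes the condition trivial) and
`v n = 0` for `n ≥ N`, then with `v = ∑_{n} v n` we have
`I^(v+k+1) = Q·I^(v+k) + 𝔞·I^(v+k+1)`. -/
theorem reduction_bound_family {A : Type*} [CommRing A] (Q I 𝔞 : Ideal A)
    (hQI : Q ≤ I) (F : ℕ → Ideal A) (hF0 : F 0 = ⊤)
    (hFI : ∀ n : ℕ, I * F n ≤ F (n + 1))
    (k : ℕ) (hk : I ^ (k + 1) ≤ Q * F k + 𝔞 * F (k + 1))
    (v : ℕ → ℕ)
    (hgen : ∀ n : ℕ, 1 ≤ n →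
      ∃ s : Finset A, s.card = v n ∧ F n = Q * F (n - 1) + I ^ n + Ideal.span (↑s : Set A))
    (N : ℕ) (hvN : ∀ n : ℕ, N ≤ n → v n = 0) :
    I ^ ((∑ n ∈ Finset.range N, v n) + k + 1)
      = Q * I ^ ((∑ n ∈ Finset.range N, v n) + k)
        + 𝔞 * I ^ ((∑ n ∈ Finset.range N, v n) + k + 1) := by
  have hgens : ∀ n, ∃ x : Fin (v n) → A, (∀ i, x i ∈ F n) ∧
      (1 ≤ n → F n ≤ Q * F (n - 1) + I ^ n + Ideal.span (Set.range x)) := by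
    intro n
    rcases Nat.eq_zero_or_pos n with rfl | hn
    · exact ⟨0, fun _ => zero_mem _, fun h => absurd h (by omega)⟩
    · obtain ⟨s, hs, hFs⟩ := hgen n hn
      have hr : Set.range (fun i => ((s.equivFinOfCardEq hs).symm i : A)) = (s : Set A) := by
        rw [← Function.comp_def, EquivLike.range_comp, Subtype.range_coe]
      refine ⟨fun i => ((s.equivFinOfCardEq hs).symm i : A), fun i => ?_, fun _ => ?_⟩
      · rw [hFs]
        exact Submodule.mem_sup_right (Ideal.subset_span (Subtype.coe_prop _))
      · rw [hr]
        exact hFs.le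
  choose x hx hFx using hgens
  have hcard : Fintype.card (Σ n : Fin N, Fin (v n)) = ∑ n ∈ Finset.range N, v n := by
    simp [Fin.sum_univ_eq_sum_range]
  rw [← hcard]
  refine pow_card_add_eq_of_generators 𝔞 hQI F hFI (fun i => (i.1 : ℕ)) (fun i => x i.1 i.2)
    (fun i => hx _ _) (fun n => (hFx (n + 1) (by omega)).trans ?_) k hk
  refine sup_le_sup_left (Ideal.span_mono ?_) _
  rintro _ ⟨j, rfl⟩
  have hn : n + 1 < N := by
    by_contra! h
    exact absurd j.pos (by rw [hvN _ h]; omega)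
  exact ⟨⟨⟨n + 1, hn⟩, j⟩, rfl, rfl⟩
end

section
/- Let (A, 𝔪) be a Noetherian local ring, Q ⊆ I ideals of A, and let {F_n}_{n≥0} be a family of ideals of A such that F_0 = A, I·F_n ⊆ F_{n+1} for all n ≥ 0, and I^{k+1} ⊆ Q·F_k + 𝔪·F_{k+1} for some integer k ≥ 0. Then the reduction number satisfies r_Q(I) ≤ k + Σ_{n≥1} μ_A(F_n/(Q·F_{n-1} + I^n)). -/
open IsLocalRing

/-- The reduction number `r_Q(I) = inf { n ≥ 0 | I^(n+1) = Q·I^n }`, an element of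
`ℕ∞` (with value `⊤` if `Q` is not a reduction of `I`). -/
noncomputable def redNum {A : Type*} [CommRing A] (Q I : Ideal A) : ℕ∞ :=
  sInf {n : ℕ∞ | ∃ m : ℕ, n = (m : ℕ∞) ∧ I ^ (m + 1) = Q * I ^ m}

section ReesDeterminant

open Polynomial
open scoped Pointwise

/-- The degree `n` part of a homogeneous generator of degree `d` over the Rees algebra of `Q`:
the ideal `Q ^ (n - d)` if `d ≤ n`, and `0` otherwise. -/
def shiftedPow {A : Type*} [CommRing A] (Q : Ideal A) (d n : ℕ) : Ideal A :=
  if d ≤ n then Q ^ (n - d) else ⊥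

/-- The degree `n` part of the extension of the ideal `Q` (placed in degree one) to the Rees
algebra of `I`. -/
def reesSpanPart {A : Type*} [CommRing A] (Q I : Ideal A) : ℕ → Ideal A
  | 0 => ⊥
  | n + 1 => Q * I ^ n

variable {A : Type*} [CommRing A] {Q I : Ideal A}

lemma mul_shiftedPow_le (d n : ℕ) : Q * shiftedPow Q d n ≤ shiftedPow Q d (n + 1) := by
  unfold shiftedPow
  by_cases h : d ≤ n
  · rw [if_pos h, if_pos (by omega), ← pow_succ', Nat.sub_add_comm h]
  · simp [h]

lemma pow_mul_reesSpanPart_le (m n : ℕ) :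
    I ^ m * reesSpanPart Q I n ≤ reesSpanPart Q I (m + n) := by
  cases n with
  | zero => simp [reesSpanPart]
  | succ n =>
    change I ^ m * (Q * I ^ n) ≤ Q * I ^ (m + n)
    rw [pow_add, mul_left_comm]

variable (Q I) in
/-- The ideal of the Rees algebra of `I` with homogeneous parts `reesSpanPart Q I n`. -/
def reesSpan : Ideal (reesAlgebra I) where
  carrier := {p | ∀ n, (p : A[X]).coeff n ∈ reesSpanPart Q I n}
  zero_mem' n := by simp
  add_mem' hp hq n := by
    simpa using add_mem (hp n) (hq n)
  smul_mem' s p hp n := by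
    simp only [smul_eq_mul, MulMemClass.coe_mul, coeff_mul]
    refine Ideal.sum_mem _ fun ij hij => ?_
    rw [← Finset.HasAntidiagonal.mem_antidiagonal.mp hij]
    exact pow_mul_reesSpanPart_le _ _ (Ideal.mul_mem_mul (s.2 _) (hp _))

lemma mem_reesSpan {p : reesAlgebra I} :
    p ∈ reesSpan Q I ↔ ∀ n, (p : A[X]).coeff n ∈ reesSpanPart Q I n := Iff.rfl

/-- The determinant trick: if a matrix over a subalgebra `S` sends a vector into `S`, then
multiplication by its determinant sends each coordinate of the vector into `S`. -/
lemma Matrix.det_mul_mem_of_mulVec_mem {R ι : Type*} [CommRing R] [Algebra A R] [Fintype ι]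
    [DecidableEq ι] (S : Subalgebra A R) (C : Matrix ι ι S) (x : ι → R)
    (h : ∀ i, ∑ j, (C i j : R) * x j ∈ S) (j : ι) : (C.det : R) * x j ∈ S := by
  have key : ∑ i, (C.adjugate j i : R) * ∑ l, (C i l : R) * x l = (C.det : R) * x j := by
    have e := congrFun (congrArg (fun M : Matrix ι ι S => (M.map S.val).mulVec x)
      C.adjugate_mul) j
    rw [Matrix.map_mul, ← Matrix.mulVec_mulVec] at e
    refine Eq.trans e ?_
    simp [Matrix.mulVec, dotProduct, Matrix.one_apply, apply_ite Subtype.val]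
  rw [← key]
  exact S.sum_mem fun i _ => S.mul_mem (C.adjugate j i).2 (h i)

lemma det_sub_prod_mem_of_lower_mem {R ι : Type*} [CommRing R] [Fintype ι] [LinearOrder ι]
    (J : Ideal R) (C : Matrix ι ι R) (a : ι → R) (hdiag : ∀ i, C i i - a i ∈ J)
    (hlow : ∀ i j, j < i → C i j ∈ J) : C.det - ∏ i, a i ∈ J := by
  rw [← Ideal.Quotient.eq, RingHom.map_det, Matrix.det_of_isUpperTriangular, map_prod]
  · exact Finset.prod_congr rfl fun i _ => Ideal.Quotient.eq.2 (hdiag i)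
  · intro i j hij
    exact Ideal.Quotient.eq_zero_iff_mem.2 (hlow i j hij)

variable {ι : Type*} [Fintype ι]

lemma exists_coeffs_of_mem {d : ι → ℕ} {x : ι → A} {n : ℕ} {f : A}
    (hf : f ∈ I ^ n ⊔ ⨆ j, shiftedPow Q (d j) n * Ideal.span {x j}) :
    ∃ b : ι → A, (∀ j, b j ∈ shiftedPow Q (d j) n) ∧ f - ∑ j, b j * x j ∈ I ^ n := by
  obtain ⟨y, hy, z, hz, rfl⟩ := Submodule.mem_sup.1 hf
  have hz' : z ∈ ⨆ j ∈ Finset.univ, shiftedPow Q (d j) n * Ideal.span {x j} := by simpa using hz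
  obtain ⟨c, rfl⟩ := (Submodule.mem_iSup_finset_iff_exists_sum _ _).1 hz'
  choose b hb hbx using fun j => Ideal.mem_mul_span_singleton.1 (c j).2
  exact ⟨b, hb, by simpa [hbx] using hy⟩

/-- A product of `card ι` elements of `I` is congruent modulo `Q * I ^ (card ι - 1)` to an element
multiplying each `F n` into `I ^ (card ι + n)`. -/
lemma exists_sub_prod_mem_forall_mul_mem [LinearOrder ι] (hQI : Q ≤ I) (F : ℕ → Ideal A)
    (hFI : ∀ n, I * F n ≤ F (n + 1)) {d : ι → ℕ} (hd : Monotone d) (x : ι → A)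
    (hx : ∀ j, x j ∈ F (d j))
    (hF : ∀ n, F n ≤ I ^ n ⊔ ⨆ j, shiftedPow Q (d j) n * Ideal.span {x j})
    (a : ι → A) (ha : ∀ i, a i ∈ I) :
    ∃ δ : A, δ - ∏ i, a i ∈ reesSpanPart Q I (Fintype.card ι) ∧
      ∀ n, ∀ f ∈ F n, δ * f ∈ I ^ (Fintype.card ι + n) := by
  choose b hb hbx using fun i =>
    exists_coeffs_of_mem (hF _ (hFI (d i) (Ideal.mul_mem_mul (ha i) (hx i))))
  have hbQ (i j) : b i j ∈ Q ^ (d i + 1 - d j) := by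
    have := hb i j
    unfold shiftedPow at this
    split_ifs at this
    · exact this
    · rw [(Submodule.mem_bot A).1 this]
      exact zero_mem _
  let D (i : ι) : reesAlgebra I :=
    ⟨monomial 1 (a i), reesAlgebra.monomial_mem.2 (by simpa using ha i)⟩
  let B : Matrix ι ι (reesAlgebra I) := fun i j =>
    ⟨monomial (d i + 1 - d j) (b i j),
      reesAlgebra.monomial_mem.2 (Ideal.pow_right_mono hQI _ (hbQ i j))⟩
  let C : Matrix ι ι (reesAlgebra I) := Matrix.diagonal D - B
  have hB (i j) (hij : j ≤ i) : B i j ∈ reesSpan Q I := by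
    intro n
    simp only [B, coeff_monomial]
    split_ifs with h
    · obtain ⟨m, rfl⟩ : ∃ m, n = m + 1 := ⟨n - 1, by have := hd hij; omega⟩
      have := hbQ i j
      rw [h, pow_succ'] at this
      exact Ideal.mul_mono_right (Ideal.pow_right_mono hQI m) this
    · exact zero_mem _
  have hdet : C.det - ∏ i, D i ∈ reesSpan Q I := by
    refine det_sub_prod_mem_of_lower_mem _ _ _ (fun i => ?_) fun i j hij => ?_
    · simpa [C] using hB i i le_rfl
    · simpa [C, Matrix.diagonal_apply_ne _ hij.ne'] using hB i j hij.le
  have hCx (j) : (C.det : A[X]) * monomial (d j) (x j) ∈ reesAlgebra I := by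
    refine Matrix.det_mul_mem_of_mulVec_mem _ _ (fun j => monomial (d j) (x j)) (fun i => ?_) j
    have : ∑ j, (C i j : A[X]) * monomial (d j) (x j) =
        monomial (d i + 1) (a i * x i - ∑ j, b i j * x j) := by
      simp only [C, Matrix.sub_apply, AddSubgroupClass.coe_sub, sub_mul, Finset.sum_sub_distrib,
        map_sub, map_sum]
      congr 1
      · rw [Finset.sum_eq_single i]
        · simp [D, monomial_mul_monomial, add_comm]
        · intro j _ hj
          simp [Matrix.diagonal_apply_ne' _ hj]
        · simp
      · refine Finset.sum_congr rfl fun j _ => ?_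
        simp only [B, monomial_mul_monomial]
        by_cases h : d j ≤ d i + 1
        · rw [Nat.sub_add_cancel h]
        · have : b i j = 0 := by simpa [shiftedPow, h] using hb i j
          simp [this]
    rw [this]
    exact reesAlgebra.monomial_mem.2 (hbx i)
  refine ⟨(C.det : A[X]).coeff (Fintype.card ι), ?_, fun n f hf => ?_⟩
  · have hD : ((∏ i, D i : reesAlgebra I) : A[X]) = monomial (Fintype.card ι) (∏ i, a i) := by
      simp only [D, SubmonoidClass.coe_finsetProd, ← C_mul_X_pow_eq_monomial, pow_one,
        Finset.prod_mul_distrib, Finset.prod_const, Finset.card_univ, map_prod]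
    simpa [hD] using hdet (Fintype.card ι)
  · obtain ⟨c, hc, hcx⟩ := exists_coeffs_of_mem (hF n hf)
    set δ := (C.det : A[X]).coeff (Fintype.card ι)
    have hδ : δ ∈ I ^ Fintype.card ι := C.det.2 _
    rw [← sub_add_cancel f (∑ j, c j * x j), mul_add, Finset.mul_sum]
    refine add_mem (pow_add I _ n ▸ Ideal.mul_mem_mul hδ hcx) (sum_mem fun j _ => ?_)
    have hδx : δ * x j ∈ I ^ (Fintype.card ι + d j) := by
      simpa [coeff_mul_monomial] using hCx j (Fintype.card ι + d j)
    have := hc j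
    unfold shiftedPow at this
    split_ifs at this with h
    · rw [show Fintype.card ι + n = (n - d j) + (Fintype.card ι + d j) by omega, pow_add,
        mul_left_comm]
      exact Ideal.mul_mem_mul (Ideal.pow_right_mono hQI _ this) hδx
    · simp [(Submodule.mem_bot A).1 this]

lemma pow_card_le_of_forall_prod_mem {T : Ideal A}
    (h : ∀ a : ι → A, (∀ i, a i ∈ I) → ∏ i, a i ∈ T) : I ^ Fintype.card ι ≤ T := by
  have e : I ^ Fintype.card ι = Ideal.span ((I : Set A) ^ Fintype.card ι) := by
    conv_lhs => rw [← Ideal.span_eq I]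
    exact Submodule.span_pow _ _
  rw [e, Ideal.span_le]
  rintro _ hy
  obtain ⟨g, hg, rfl⟩ := Set.mem_pow_iff_prod.1 hy
  have := h (fun i => g (Fintype.equivFin ι i)) fun i => hg _
  rwa [Equiv.prod_comp (Fintype.equivFin ι) g] at this

/-- The reduction statement for a filtration generated over the Rees algebra of `Q` by powers of
`I` and by finitely many elements `x j` of degree `d j`. -/
theorem pow_succ_eq_mul_pow_of_generators [IsNoetherianRing A] [IsLocalRing A] [LinearOrder ι]
    (hQI : Q ≤ I) (F : ℕ → Ideal A) (hFI : ∀ n, I * F n ≤ F (n + 1)) {d : ι → ℕ}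
    (hd : Monotone d) (x : ι → A) (hx : ∀ j, x j ∈ F (d j))
    (hF : ∀ n, F n ≤ I ^ n ⊔ ⨆ j, shiftedPow Q (d j) n * Ideal.span {x j})
    (k : ℕ) (hk : I ^ (k + 1) ≤ Q * F k + maximalIdeal A * F (k + 1)) :
    I ^ (k + Fintype.card ι + 1) = Q * I ^ (k + Fintype.card ι) := by
  set c := Fintype.card ι with hc
  refine le_antisymm ?_ (by rw [pow_succ']; exact Ideal.mul_mono_left hQI)
  refine Submodule.le_of_le_smul_of_le_jacobson_bot (I := maximalIdeal A)
    (IsNoetherian.noetherian _) (maximalIdeal_le_jacobson ⊥) ?_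
  rw [smul_eq_mul, show k + c + 1 = c + (k + 1) by omega, pow_add, Ideal.mul_le]
  rw [← pow_add]
  intro y hy z hz
  suffices I ^ c ≤ Submodule.comap (LinearMap.mulRight A z)
      (Q * I ^ (k + c) ⊔ maximalIdeal A * I ^ (c + (k + 1))) from this hy
  refine pow_card_le_of_forall_prod_mem fun a ha => ?_
  obtain ⟨δ, hδ, hδF⟩ := exists_sub_prod_mem_forall_mul_mem hQI F hFI hd x hx hF a ha
  change (∏ i, a i) * z ∈ Q * I ^ (k + c) ⊔ maximalIdeal A * I ^ (c + (k + 1))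
  rw [← sub_sub_cancel δ (∏ i, a i), sub_mul]
  refine sub_mem ?_ (Submodule.mem_sup_left ?_)
  · have hmul (J : Ideal A) (n : ℕ) :
        J * F n ≤ Submodule.comap (LinearMap.mulLeft A δ) (J * I ^ (c + n)) := by
      refine Ideal.mul_le.2 fun r hr f hf => ?_
      change δ * (r * f) ∈ J * I ^ (c + n)
      rw [mul_left_comm]
      exact Ideal.mul_mem_mul hr (hδF n f hf)
    obtain ⟨u, hu, w, hw, rfl⟩ := Submodule.mem_sup.1 (hk hz)
    rw [mul_add, add_comm k c]
    exact Submodule.add_mem_sup (hmul Q k hu) (hmul _ (k + 1) hw)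
  · rw [← hc] at hδ
    have := pow_mul_reesSpanPart_le (k + 1) c (Ideal.mul_mem_mul hz hδ)
    rw [mul_comm, show k + 1 + c = k + c + 1 by omega] at this
    exact this

end ReesDeterminant

/-- **Corollary 1.2, first inequality.**  Let `(A, 𝔪)` be a Noetherian local ring,
`Q ⊆ I` ideals, and `{F n}` a family of ideals with `F 0 = A`, `I·F n ⊆ F (n+1)`,
and `I^(k+1) ⊆ Q·F k + 𝔪·F (k+1)` for some `k ≥ 0`.  If for every `n ≥ 1` the
module `F n / (Q·F (n-1) + I^n)` is generated by `v n` elements, with `v n = 0`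
for `n > N` (so that `∑_{n ≥ 1} μ_A(F n / (Q·F (n-1) + I^n)) ≤ ∑_{n=1}^N v n`),
then `r_Q(I) ≤ k + ∑_{n=1}^N v n`. -/
theorem reduction_number_le_sum_mu {A : Type*} [CommRing A] [IsNoetherianRing A]
    [IsLocalRing A] (Q I : Ideal A) (hQI : Q ≤ I)
    (F : ℕ → Ideal A) (hF0 : F 0 = ⊤)
    (hFI : ∀ n : ℕ, I * F n ≤ F (n + 1))
    (k : ℕ) (hk : I ^ (k + 1) ≤ Q * F k + maximalIdeal A * F (k + 1))
    (v : ℕ → ℕ)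
    (hgen : ∀ n : ℕ, 1 ≤ n →
      ∃ s : Finset A, s.card = v n ∧ F n = Q * F (n - 1) + I ^ n + Ideal.span (↑s : Set A))
    (N : ℕ) (hvN : ∀ n : ℕ, N < n → v n = 0) :
    redNum Q I ≤ ((k + ∑ n ∈ Finset.Icc 1 N, v n : ℕ) : ℕ∞) := by
  classical
  choose s hs hFs using fun n : ℕ => hgen (n + 1) (by omega)
  let e (n : ℕ) : Fin (v (n + 1)) ≃ s n := (finCongr (hs n).symm).trans (s n).equivFin.symm
  let ι := Σₗ n : Fin N, Fin (v (n + 1))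
  let d : ι → ℕ := fun j => (ofLex j).1 + 1
  let x : ι → A := fun j => e _ (ofLex j).2
  have hd : Monotone d := by
    intro i j hij
    rcases Sigma.Lex.le_def.1 hij with h | ⟨h, -⟩
    · exact Nat.succ_le_succ (Fin.lt_def.1 h).le
    · exact (congrArg (fun n : Fin N => (n : ℕ) + 1) h).le
  have hx (j : ι) : x j ∈ F (d j) := by
    rw [hFs]
    exact Submodule.mem_sup_right (Ideal.subset_span (e _ (ofLex j).2).2)
  have hF (n : ℕ) : F n ≤ I ^ n ⊔ ⨆ j, shiftedPow Q (d j) n * Ideal.span {x j} := by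
    induction n with
    | zero => simp
    | succ n ih =>
      rw [hFs n, Nat.add_sub_cancel]
      refine sup_le (sup_le ?_ le_sup_left) (Ideal.span_le.2 fun y hy => ?_)
      · refine (Ideal.mul_mono_right ih).trans ?_
        rw [Ideal.mul_sup, Submodule.mul_iSup]
        refine sup_le_sup ?_ (iSup_mono fun j => ?_)
        · rw [pow_succ']
          exact Ideal.mul_mono_left hQI
        · rw [← mul_assoc]
          exact Ideal.mul_mono_left (mul_shiftedPow_le _ _)
      · have hn : n < N := by
          by_contra h
          have := hs n
          rw [hvN (n + 1) (by omega), Finset.card_eq_zero] at this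
          simp [this] at hy
        let j : ι := toLex ⟨⟨n, hn⟩, (e n).symm ⟨y, hy⟩⟩
        have hj : x j = y := congrArg Subtype.val ((e n).apply_symm_apply ⟨y, hy⟩)
        refine Submodule.mem_sup_right (Submodule.mem_iSup_of_mem j ?_)
        rw [hj, show shiftedPow Q (d j) (n + 1) = ⊤ by simp [shiftedPow, d, j], Ideal.top_mul]
        exact Ideal.mem_span_singleton_self y
  have hcard : Fintype.card ι = ∑ n ∈ Finset.Icc 1 N, v n := by
    rw [Fintype.card_lex, Fintype.card_sigma]
    simp only [Fintype.card_fin]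
    rw [Fin.sum_univ_eq_sum_range fun n => v (n + 1), Finset.range_eq_Ico,
      Finset.sum_Ico_add' v 0 N 1]
    rfl
  refine sInf_le ⟨_, rfl, ?_⟩
  rw [← hcard]
  exact pow_succ_eq_mul_pow_of_generators hQI F hFI hd x hx hF k hk
end

section
/- Let (A, 𝔪) be a Noetherian local ring, Q ⊆ I ideals of A, and let {F_n}_{n≥0} be a family of ideals of A such that F_0 = A, I·F_n ⊆ F_{n+1} for all n ≥ 0, and I^{k+1} ⊆ Q·F_k + 𝔪·F_{k+1} for some integer k ≥ 0. Then the reduction number satisfies r_Q(I) ≤ 1 + μ_A(F_1/I) + Σ_{n≥2} μ_A(F_n/Q·F_{n-1}). -/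
open IsLocalRing

open Polynomial in
/-- The ideal `(Q X)` of the Rees algebra of `I`, for `Q ≤ I`. -/
noncomputable def reesShift {A : Type*} [CommRing A] (Q I : Ideal A) : Ideal (reesAlgebra I) :=
  Ideal.span {p | ∃ q ∈ Q, (p : A[X]) = monomial 1 q}

section Rees

open Polynomial
open scoped Pointwise

variable {A : Type*} [CommRing A] {Q I : Ideal A}

lemma coeff_of_mem_reesShift {p : reesAlgebra I} (hp : p ∈ reesShift Q I) :
    (p : A[X]).coeff 0 = 0 ∧ ∀ n, (p : A[X]).coeff (n + 1) ∈ Q * I ^ n := by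
  induction hp using Submodule.span_induction with
  | mem p hp =>
    obtain ⟨q, hq, hpq⟩ := hp
    rw [hpq]
    refine ⟨by simp [coeff_monomial], fun n => ?_⟩
    rw [coeff_monomial]
    split_ifs with h
    · obtain rfl : n = 0 := by omega
      simpa using hq
    · exact zero_mem _
  | zero => simp
  | add p p' _ _ h h' =>
    exact ⟨by simp [h.1, h'.1], fun n => by simpa using add_mem (h.2 n) (h'.2 n)⟩
  | smul b p _ h =>
    refine ⟨by simp [mul_coeff_zero, h.1], fun n => ?_⟩
    rw [smul_eq_mul, Subalgebra.coe_mul, coeff_mul]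
    refine sum_mem fun ij hij => ?_
    obtain ⟨i, j⟩ := ij
    rw [Finset.HasAntidiagonal.mem_antidiagonal] at hij
    cases j with
    | zero => simp [h.1]
    | succ j =>
      obtain rfl : i + j = n := by
        simp only at hij
        omega
      rw [pow_add, mul_left_comm]
      exact Ideal.mul_mem_mul (b.2 i) (h.2 j)

lemma coeff_mul_mem_of_mem_reesShift {p : reesAlgebra I} (hp : p ∈ reesShift Q I) (n m : ℕ)
    {y : A} (hy : y ∈ I ^ (m + 1)) : (p : A[X]).coeff n * y ∈ Q * I ^ (n + m) := by
  cases n with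
  | zero => simp [(coeff_of_mem_reesShift hp).1]
  | succ n =>
    rw [add_right_comm, add_assoc, pow_add, ← mul_assoc]
    exact Ideal.mul_mem_mul ((coeff_of_mem_reesShift hp).2 n) hy

/-- A system of generators `f i ∈ F (d i)` expresses every element of `F n` modulo the Rees
algebra of `I`, with coefficients in `(Q X)` for the generators of degree less than `n`. -/
lemma exists_rees_coeffs (hQI : Q ≤ I) {F : ℕ → Ideal A} {ι : Type*} [Fintype ι] (d : ι → ℕ)
    (f : ι → A)
    (hF : ∀ n, F (n + 1) ≤ I ^ (n + 1) ⊔ Q * F n ⊔ Ideal.span {a | ∃ i, d i = n + 1 ∧ f i = a})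
    (n : ℕ) (y : A) (hy : y ∈ F n) :
    ∃ c : ι → reesAlgebra I, (∀ i, d i < n → c i ∈ reesShift Q I) ∧
      monomial n y - ∑ i, (c i : A[X]) * monomial (d i) (f i) ∈ reesAlgebra I := by
  classical
  induction n generalizing y with
  | zero =>
    exact ⟨0, by simp, by simpa using (reesAlgebra I).algebraMap_mem y⟩
  | succ n ih =>
    have hadd : ∀ y z : A,
        (∃ c : ι → reesAlgebra I, (∀ i, d i < n + 1 → c i ∈ reesShift Q I) ∧
          monomial (n + 1) y - ∑ i, (c i : A[X]) * monomial (d i) (f i) ∈ reesAlgebra I) →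
        (∃ c : ι → reesAlgebra I, (∀ i, d i < n + 1 → c i ∈ reesShift Q I) ∧
          monomial (n + 1) z - ∑ i, (c i : A[X]) * monomial (d i) (f i) ∈ reesAlgebra I) →
        (∃ c : ι → reesAlgebra I, (∀ i, d i < n + 1 → c i ∈ reesShift Q I) ∧
          monomial (n + 1) (y + z) - ∑ i, (c i : A[X]) * monomial (d i) (f i)
            ∈ reesAlgebra I) := by
      rintro y z ⟨c, hc, h⟩ ⟨c', hc', h'⟩
      refine ⟨c + c', fun i hi => add_mem (hc i hi) (hc' i hi), ?_⟩
      convert add_mem h h' using 1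
      simp only [Pi.add_apply, Subalgebra.coe_add, add_mul, Finset.sum_add_distrib, map_add]
      ring
    obtain ⟨u, hu, s, hs, rfl⟩ := Submodule.mem_sup.1 (hF n hy)
    obtain ⟨a, ha, b, hb, rfl⟩ := Submodule.mem_sup.1 hu
    refine hadd _ _ (hadd _ _ ?_ ?_) ?_
    · exact ⟨0, by simp, by simpa using reesAlgebra.monomial_mem.2 ha⟩
    · clear hy hu
      induction hb using Submodule.mul_induction_on' with
      | add y _ z _ h h' => exact hadd y z h h'
      | mem_mul_mem q hq y hy =>
        obtain ⟨c, -, h⟩ := ih y hy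
        have hqX : monomial 1 q ∈ reesAlgebra I :=
          reesAlgebra.monomial_mem.2 (by simpa using hQI hq)
        refine ⟨fun i => c i * ⟨_, hqX⟩, fun i _ =>
          Ideal.mul_mem_left _ _ (Ideal.subset_span ⟨q, hq, rfl⟩), ?_⟩
        convert mul_mem hqX h using 1
        simp only [mul_sub, monomial_mul_monomial, Finset.mul_sum, Subalgebra.coe_mul,
          add_comm 1 n]
        congr 1
        exact Finset.sum_congr rfl fun i _ => by ring
    · clear hy hu
      induction hs using Submodule.span_induction with
      | zero => exact ⟨0, by simp, by simp⟩
      | add y z _ _ h h' => exact hadd y z h h'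
      | mem y hy =>
        obtain ⟨i, hi, rfl⟩ := hy
        refine ⟨Pi.single i 1, fun j hj => ?_, ?_⟩
        · rw [Pi.single_eq_of_ne (by rintro rfl; omega)]
          exact zero_mem _
        · rw [Finset.sum_eq_single i (fun j _ hj => by simp [Pi.single_eq_of_ne hj]) (by simp)]
          simp [hi]
      | smul a y _ h =>
        obtain ⟨c, hc, h⟩ := h
        refine ⟨fun i => algebraMap A _ a * c i, fun i hi => Ideal.mul_mem_left _ _ (hc i hi), ?_⟩
        convert (reesAlgebra I).smul_mem h a using 1
        simp only [smul_sub, Finset.smul_sum, smul_monomial, Subalgebra.coe_mul]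
        congr 1
        refine Finset.sum_congr rfl fun i _ => ?_
        rw [Algebra.smul_def, mul_assoc]
        rfl

lemma exists_lt_of_perm_ne_one {ι : Type*} [Fintype ι] (d : ι → ℕ) {σ : Equiv.Perm ι}
    (hσ : σ ≠ 1) : ∃ i, σ i ≠ i ∧ d (σ i) ≤ d i := by
  by_contra! h
  obtain ⟨i, hi⟩ : ∃ i, σ i ≠ i := by
    by_contra! h'
    exact hσ (Equiv.ext h')
  have : ∑ i, d i < ∑ i, d (σ i) := by
    refine Finset.sum_lt_sum (fun j _ => ?_) ⟨i, Finset.mem_univ _, h i hi⟩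
    by_cases hj : σ j = j
    · rw [hj]
    · exact (h j hj).le
  exact this.ne (Equiv.sum_comp σ d).symm

/-- The determinant trick in the Rees algebra. -/
lemma exists_rees_det (hQI : Q ≤ I) {F : ℕ → Ideal A} (hFI : ∀ n, I * F n ≤ F (n + 1))
    {ι : Type*} [Fintype ι] (d : ι → ℕ) (f : ι → A) (hf : ∀ i, f i ∈ F (d i))
    (hF : ∀ n, F (n + 1) ≤ I ^ (n + 1) ⊔ Q * F n ⊔ Ideal.span {a | ∃ i, d i = n + 1 ∧ f i = a})
    (x : ι → reesAlgebra I) (hx : ∀ i, ∃ a ∈ I, (x i : A[X]) = monomial 1 a) :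
    ∃ D : reesAlgebra I, D - ∏ i, x i ∈ reesShift Q I ∧
      ∀ n, ∀ y ∈ F n, (D : A[X]) * monomial n y ∈ reesAlgebra I := by
  classical
  have hrep := exists_rees_coeffs hQI d f hF
  have hc : ∀ i, ∃ c : ι → reesAlgebra I, (∀ j, d j < d i + 1 → c j ∈ reesShift Q I) ∧
      (x i : A[X]) * monomial (d i) (f i) - ∑ j, (c j : A[X]) * monomial (d j) (f j)
        ∈ reesAlgebra I := by
    intro i
    obtain ⟨a, ha, hxa⟩ := hx i
    rw [hxa, monomial_mul_monomial, add_comm 1]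
    exact hrep _ _ (hFI _ (Ideal.mul_mem_mul ha (hf i)))
  choose c hcK hcB using hc
  let M : Matrix ι ι (reesAlgebra I) := Matrix.diagonal x - Matrix.of c
  have hMv : ∀ i, ∑ j, (M i j : A[X]) * monomial (d j) (f j) ∈ reesAlgebra I := by
    intro i
    convert hcB i using 1
    simp only [M, Matrix.sub_apply, Matrix.of_apply, Subalgebra.coe_sub, sub_mul,
      Finset.sum_sub_distrib]
    congr 1
    rw [Finset.sum_eq_single i (fun j _ hj => by simp [Matrix.diagonal_apply_ne _ hj.symm])
      (by simp), Matrix.diagonal_apply_eq]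
  have hdet : ∀ l, (M.det : A[X]) * monomial (d l) (f l) ∈ reesAlgebra I := by
    intro l
    have h : (M.det : A[X]) * monomial (d l) (f l) =
        ∑ i, (M.adjugate l i : A[X]) * ∑ j, (M i j : A[X]) * monomial (d j) (f j) := by
      simp only [Finset.mul_sum, ← mul_assoc]
      rw [Finset.sum_comm]
      simp only [← Finset.sum_mul]
      have hadj : ∀ j, ∑ i, (M.adjugate l i : A[X]) * (M i j : A[X]) =
          ((if l = j then M.det else 0 : reesAlgebra I) : A[X]) := by
        intro j
        have := congrFun (congrFun (Matrix.adjugate_mul M) l) j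
        rw [Matrix.mul_apply] at this
        have h2 := congrArg (Subtype.val) this
        simpa [Matrix.one_apply] using h2
      simp only [hadj]
      rw [Finset.sum_eq_single l (fun j _ hj => by simp [hj.symm]) (by simp)]
      simp
    rw [h]
    exact sum_mem fun i _ => mul_mem (M.adjugate l i).2 (hMv i)
  refine ⟨M.det, ?_, fun n y hy => ?_⟩
  · rw [← Ideal.Quotient.eq]
    rw [Matrix.det_apply, map_sum, Finset.sum_eq_single 1]
    · simp only [Equiv.Perm.sign_one, one_smul, Equiv.Perm.one_apply, map_prod]
      refine Finset.prod_congr rfl fun i _ => ?_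
      simp only [M, Matrix.sub_apply,
        Matrix.diagonal_apply_eq, Matrix.of_apply]
      rw [Ideal.Quotient.eq]
      simpa using hcK i i (by omega)
    · intro σ _ hσ
      obtain ⟨i, hi, hdi⟩ := exists_lt_of_perm_ne_one d (σ := σ⁻¹) (by simpa using hσ)
      rw [Ideal.Quotient.eq_zero_iff_mem, Units.smul_def, zsmul_eq_mul]
      refine Ideal.mul_mem_left _ _ (Ideal.mem_of_dvd _
        (Finset.dvd_prod_of_mem _ (Finset.mem_univ (σ⁻¹ i))) ?_)
      have h := hcK i (σ⁻¹ i) (by omega)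
      rw [show σ (σ⁻¹ i) = i from σ.apply_symm_apply i]
      simp only [M, Matrix.sub_apply, Matrix.of_apply, Matrix.diagonal_apply_ne _ hi.symm, zero_sub]
      exact neg_mem h
    · simp
  · obtain ⟨c, -, h⟩ := hrep n y hy
    have h1 := mul_mem M.det.2 h
    rw [mul_sub, Finset.mul_sum] at h1
    have h2 : ∑ i, (M.det : A[X]) * ((c i : A[X]) * monomial (d i) (f i)) ∈ reesAlgebra I :=
      sum_mem fun i _ => by
        rw [mul_left_comm]
        exact mul_mem (c i).2 (hdet i)
    simpa using add_mem h1 h2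

/-- If the family `F` has generators `f i ∈ F (d i)` in positive degrees modulo `Q F` and the
powers of `I`, then the reduction number exceeds `k` by at most the number of generators. -/
lemma pow_eq_mul_pow_of_generators [IsNoetherianRing A] [IsLocalRing A] (hQI : Q ≤ I)
    {F : ℕ → Ideal A} (hFI : ∀ n, I * F n ≤ F (n + 1)) {k : ℕ}
    (hk : I ^ (k + 1) ≤ Q * F k + maximalIdeal A * F (k + 1))
    {ι : Type*} [Fintype ι] (d : ι → ℕ) (f : ι → A) (hf : ∀ i, f i ∈ F (d i))
    (hF : ∀ n, F (n + 1) ≤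
      I ^ (n + 1) ⊔ Q * F n ⊔ Ideal.span {a | ∃ i, d i = n + 1 ∧ f i = a}) :
    I ^ (k + Fintype.card ι + 1) = Q * I ^ (k + Fintype.card ι) := by
  set ν := Fintype.card ι with hν
  have hle : Q * I ^ (k + ν) ≤ I ^ (k + ν + 1) := by
    rw [pow_succ']
    exact Ideal.mul_mono_left hQI
  refine le_antisymm ?_ hle
  refine Submodule.le_of_le_smul_of_le_jacobson_bot (I := maximalIdeal A)
    (IsNoetherian.noetherian _) (IsLocalRing.jacobson_eq_maximalIdeal _ bot_ne_top).ge ?_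
  rw [smul_eq_mul]
  have hprod : ∀ x : ι → A, (∀ i, x i ∈ I) → ∀ y ∈ I ^ (k + 1), (∏ i, x i) * y ∈
      Q * I ^ (k + ν) ⊔ maximalIdeal A * I ^ (k + ν + 1) := by
    intro x hx y hy
    obtain ⟨D, hD, hDF⟩ := exists_rees_det hQI hFI d f hf hF
      (fun i => ⟨monomial 1 (x i), reesAlgebra.monomial_mem.2 (by simpa using hx i)⟩)
      (fun i => ⟨x i, hx i, rfl⟩)
    have hDn : ∀ n, ∀ z ∈ F n, (D : A[X]).coeff ν * z ∈ I ^ (n + ν) := by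
      intro n z hz
      have := hDF n z hz (n + ν)
      rw [add_comm n ν] at this ⊢
      rwa [coeff_mul_monomial] at this
    have hcoeff : (((D - ∏ i, (⟨monomial 1 (x i),
        reesAlgebra.monomial_mem.2 (by simpa using hx i)⟩ : reesAlgebra I) :
        reesAlgebra I)) : A[X]).coeff ν = (D : A[X]).coeff ν - ∏ i, x i := by
      have hm : ∏ i, monomial 1 (x i) = monomial ν (∏ i, x i) := by
        simp [← C_mul_X_pow_eq_monomial, Finset.prod_mul_distrib, hν]
      simp [hm]
    have h1 := coeff_mul_mem_of_mem_reesShift hD ν k hy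
    rw [hcoeff, add_comm ν] at h1
    have h2 : (D : A[X]).coeff ν * y ∈
        Q * I ^ (k + ν) ⊔ maximalIdeal A * I ^ (k + ν + 1) := by
      have h3 : Ideal.span {(D : A[X]).coeff ν} * (Q * F k + maximalIdeal A * F (k + 1)) ≤
          Q * I ^ (k + ν) ⊔ maximalIdeal A * I ^ (k + ν + 1) := by
        rw [mul_add, mul_left_comm _ Q, mul_left_comm _ (maximalIdeal A)]
        refine sup_le_sup (Ideal.mul_mono_right ?_) (Ideal.mul_mono_right ?_)
        · exact Ideal.span_singleton_mul_le_iff.2 (hDn k)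
        · rw [add_right_comm]
          exact Ideal.span_singleton_mul_le_iff.2 (hDn (k + 1))
      exact h3 (Ideal.mul_mem_mul (Ideal.mem_span_singleton_self _) (hk hy))
    have h4 := sub_mem h2 (Ideal.mem_sup_left h1)
    rwa [← sub_mul, sub_sub_cancel] at h4
  have hpow : I ^ (k + ν + 1) = (∏ _i : ι, I) * I ^ (k + 1) := by
    rw [Finset.prod_const, Finset.card_univ, ← pow_add]
    congr 1
    omega
  rw [hpow, Ideal.mul_le]
  intro r hr y hy
  rw [← hpow]
  have hspan : ∏ _i : ι, I = Ideal.span (∏ _i : ι, (I : Set A)) := by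
    rw [← Ideal.prod_span]
    simp
  rw [hspan] at hr
  induction hr using Submodule.span_induction with
  | zero => simp
  | add r r' _ _ h h' => simpa only [add_mul] using add_mem h h'
  | smul a r _ h =>
    rw [smul_eq_mul, mul_assoc]
    exact Ideal.mul_mem_left _ a h
  | mem r hr =>
    obtain ⟨x, hx, rfl⟩ := (Set.mem_fintype_prod _ _).1 hr
    exact hprod x (fun i => hx i) y hy

end Rees

/-- One generator of `H` modulo `G` can be traded for an ideal `J ≤ H` not contained in
`G + 𝔪 H`. -/
lemma exists_generators_card_lt {A : Type*} [CommRing A] [IsLocalRing A] {G H J : Ideal A}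
    {s : Finset A} (hH : H = G + Ideal.span (s : Set A)) (hJH : J ≤ H)
    (hJ : ¬ J ≤ G + maximalIdeal A * H) :
    ∃ t : Finset A, t.card + 1 ≤ s.card ∧ t ⊆ s ∧ H ≤ J ⊔ G ⊔ Ideal.span (t : Set A) := by
  classical
  obtain ⟨y, hyJ, hy⟩ := SetLike.not_le_iff_exists.1 hJ
  have hyH := hJH hyJ
  rw [hH] at hyH
  obtain ⟨g, hg, z, hz, rfl⟩ := Submodule.mem_sup.1 hyH
  obtain ⟨a, -, rfl⟩ := Submodule.mem_span_finset.1 hz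
  have hsH : ∀ b ∈ s, b ∈ H := fun b hb => by
    rw [hH]
    exact Ideal.mem_sup_right (Ideal.subset_span hb)
  obtain ⟨b, hb, hab⟩ : ∃ b ∈ s, a b ∉ maximalIdeal A := by
    by_contra! h
    exact hy (add_mem (Ideal.mem_sup_left hg) (Ideal.mem_sup_right
      (sum_mem fun b hb => Ideal.mul_mem_mul (h b hb) (hsH b hb))))
  refine ⟨s.erase b, by rw [Finset.card_erase_add_one hb], Finset.erase_subset _ _, ?_⟩
  set L := J ⊔ G ⊔ Ideal.span ((s.erase b : Finset A) : Set A) with hL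
  have hGL : G ≤ L := le_sup_right.trans le_sup_left
  have hJL : J ≤ L := le_sup_left.trans le_sup_left
  have her : ∀ c ∈ s.erase b, c ∈ L := fun c hc =>
    Ideal.mem_sup_right (Ideal.subset_span hc)
  have hu : IsUnit (a b) := by simpa using hab
  have hbL : b ∈ L := by
    have h1 := sub_mem (hJL hyJ) (hGL hg)
    rw [add_sub_cancel_left, ← Finset.add_sum_erase _ _ hb] at h1
    have h2 := sub_mem h1 (sum_mem fun c hc => L.mul_mem_left (a c) (her c hc))
    simp only [smul_eq_mul, add_sub_cancel_right] at h2
    exact (Ideal.unit_mul_mem_iff_mem _ hu).1 h2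
  rw [hH]
  refine sup_le hGL (Ideal.span_le.2 fun c hc => ?_)
  by_cases hcb : c = b
  · exact hcb ▸ hbL
  · exact her c (Finset.mem_erase.2 ⟨hcb, hc⟩)

/-- **Corollary 1.2, second inequality.**  Let `(A, 𝔪)` be a Noetherian local ring,
`Q ⊆ I` ideals, and `{F n}` a family of ideals with `F 0 = A`, `I·F n ⊆ F (n+1)`,
and `I^(k+1) ⊆ Q·F k + 𝔪·F (k+1)` for some `k ≥ 0`.  If `F 1 / I` is generated by
`v₁` elements and, for each `n ≥ 2`, `F n / (Q·F (n-1))` is generated by `w n`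
elements with `w n = 0` for `n > N`, then
`r_Q(I) ≤ 1 + v₁ + ∑_{n=2}^N w n`. -/
theorem reduction_number_le_one_add_sum_mu {A : Type*} [CommRing A] [IsNoetherianRing A]
    [IsLocalRing A] (Q I : Ideal A) (hQI : Q ≤ I)
    (F : ℕ → Ideal A) (hF0 : F 0 = ⊤)
    (hFI : ∀ n : ℕ, I * F n ≤ F (n + 1))
    (k : ℕ) (hk : I ^ (k + 1) ≤ Q * F k + maximalIdeal A * F (k + 1))
    (v₁ : ℕ)
    (hgen1 : ∃ s : Finset A, s.card = v₁ ∧ F 1 = I + Ideal.span (↑s : Set A))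
    (w : ℕ → ℕ)
    (hgen : ∀ n : ℕ, 2 ≤ n →
      ∃ s : Finset A, s.card = w n ∧ F n = Q * F (n - 1) + Ideal.span (↑s : Set A))
    (N : ℕ) (hwN : ∀ n : ℕ, N < n → w n = 0) :
    redNum Q I ≤ ((1 + v₁ + ∑ n ∈ Finset.Icc 2 N, w n : ℕ) : ℕ∞) := by
  classical
  have hex : ∃ k, 1 ≤ k ∧ I ^ (k + 1) ≤ Q * F k + maximalIdeal A * F (k + 1) := by
    refine ⟨k + 1, by omega, ?_⟩
    calc I ^ (k + 1 + 1) = I * I ^ (k + 1) := pow_succ' _ _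
      _ ≤ I * (Q * F k + maximalIdeal A * F (k + 1)) := Ideal.mul_mono_right hk
      _ = Q * (I * F k) + maximalIdeal A * (I * F (k + 1)) := by ring
      _ ≤ _ := sup_le_sup (Ideal.mul_mono_right (hFI k)) (Ideal.mul_mono_right (hFI (k + 1)))
  obtain ⟨m, ⟨hm1, hm⟩, hmin⟩ : ∃ m, (1 ≤ m ∧
      I ^ (m + 1) ≤ Q * F m + maximalIdeal A * F (m + 1)) ∧ ∀ j < m, ¬ (1 ≤ j ∧
      I ^ (j + 1) ≤ Q * F j + maximalIdeal A * F (j + 1)) :=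
    ⟨Nat.find hex, Nat.find_spec hex, fun j hj => Nat.find_min hex hj⟩
  have hIF : ∀ n, I ^ n ≤ F n := by
    intro n
    induction n with
    | zero => simp [hF0]
    | succ n ih =>
      rw [pow_succ']
      exact (Ideal.mul_mono_right ih).trans (hFI n)
  -- generators modulo `Q F + I ^ n`, one fewer than `w n` in degrees `2 ≤ n ≤ m`
  have hS : ∀ n, ∃ S : Finset A, (n = 0 → S.card ≤ v₁) ∧
      (1 ≤ n → S.card + (if n + 1 ≤ m then 1 else 0) ≤ w (n + 1)) ∧ (∀ b ∈ S, b ∈ F (n + 1)) ∧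
      F (n + 1) ≤ I ^ (n + 1) ⊔ Q * F n ⊔ Ideal.span (S : Set A) := by
    intro n
    rcases Nat.eq_zero_or_pos n with rfl | hn
    · obtain ⟨s, hs, hsF⟩ := hgen1
      refine ⟨s, fun _ => hs.le, by omega, fun b hb => ?_, ?_⟩
      · rw [zero_add, hsF]
        exact Ideal.mem_sup_right (Ideal.subset_span hb)
      · rw [zero_add, hsF, pow_one]
        exact sup_le_sup le_sup_left le_rfl
    · obtain ⟨s, hs, hsF⟩ := hgen (n + 1) (by omega)
      rw [Nat.add_sub_cancel] at hsF
      have hsm : ∀ b ∈ s, b ∈ F (n + 1) := fun b hb => by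
        rw [hsF]
        exact Ideal.mem_sup_right (Ideal.subset_span hb)
      by_cases hnm : n + 1 ≤ m
      · obtain ⟨t, hts, htsub, ht⟩ := exists_generators_card_lt hsF (hIF (n + 1))
          fun h => hmin n (by omega) ⟨hn, h⟩
        exact ⟨t, by omega, fun _ => by rw [if_pos hnm, ← hs]; exact hts,
          fun b hb => hsm b (htsub hb), ht⟩
      · refine ⟨s, by omega, fun _ => by rw [if_neg hnm, hs, add_zero], hsm, ?_⟩
        nth_rw 1 [hsF]
        exact sup_le_sup le_sup_right le_rfl
  choose S hS0 hSw hSF hSgen using hS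
  have hSN : ∀ n, N < n → S n = ∅ := by
    intro n hn
    have h1 := hSw n (by omega)
    rw [hwN (n + 1) (by omega)] at h1
    exact Finset.card_eq_zero.1 (by omega)
  have hmain := pow_eq_mul_pow_of_generators hQI hFI hm
    (ι := (Finset.range (N + 1)).sigma S) (fun i => i.1.1 + 1) (fun i => i.1.2)
    (fun i => hSF _ _ (Finset.mem_sigma.1 i.2).2)
    (fun n => (hSgen n).trans (sup_le_sup le_rfl (Ideal.span_mono fun b hb => by
      have hn : n < N + 1 := by
        by_contra! h
        simp [hSN n (by omega)] at hb
      exact ⟨⟨⟨n, b⟩, Finset.mem_sigma.2 ⟨Finset.mem_range.2 hn, hb⟩⟩, rfl, rfl⟩)))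
  refine (show redNum Q I ≤ _ from sInf_le ⟨_, rfl, hmain⟩).trans (Nat.cast_le.2 ?_)
  rw [Fintype.card_coe, Finset.card_sigma, Finset.sum_range_succ']
  have hle : ∀ M, ∑ n ∈ Finset.range M, (S (n + 1)).card + (min m (M + 1) - 1) ≤
      ∑ n ∈ Finset.Icc 2 (M + 1), w n := by
    intro M
    induction M with
    | zero => simp
    | succ M ih =>
      rw [Finset.sum_range_succ, Finset.sum_Icc_succ_top (by omega)]
      have h1 := hSw (M + 1) (by omega)
      split_ifs at h1 <;> omega
  have h1 := hle N
  have hw : ∑ n ∈ Finset.Icc 2 (N + 1), w n = ∑ n ∈ Finset.Icc 2 N, w n := by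
    rcases Nat.eq_zero_or_pos N with rfl | hN
    · simp
    · rw [Finset.sum_Icc_succ_top (by omega), hwN (N + 1) (by omega), add_zero]
  have hmN : m ≤ N + 1 := by
    by_contra! h
    have h2 := hSw (m - 1) (by omega)
    rw [if_pos (by omega), hwN _ (by omega)] at h2
    omega
  have h0 := hS0 0 rfl
  rw [min_eq_left hmN] at h1
  omega
end

section
/- Let A be a commutative ring, Q ⊆ I ideals of A, and let I_1, I_2, …, I_N be finitely many ideals of A such that, for each 1 ≤ n ≤ N, the ideal I_n is generated by v_n elements and I·I_n ⊆ I^{n+1} + Σ_{ℓ=1}^{N} Q^{n+1−ℓ}·I_ℓ. Set v = v_1 + v_2 + ⋯ + v_N and assume v > 0. Then for any v elements a_1, a_2, …, a_v of I, there exists σ ∈ Q·I^{v−1} such that a_1·a_2⋯a_v − σ ∈ ⋂_{n=1}^{N} (I^{n+v} : I_n). -/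
/-- If the `(i, j)` entry of a square matrix lies in `I ^ (r i - e j)`, then its determinant lies in
`I ^ (∑ i, r i - ∑ j, e j)`. -/
theorem Matrix.det_mem_ideal_pow {A ι : Type*} [CommRing A] [Fintype ι] [DecidableEq ι]
    (I : Ideal A) (M : Matrix ι ι A) (r e : ι → ℕ) (hM : ∀ i j, M i j ∈ I ^ (r i - e j)) :
    M.det ∈ I ^ (∑ i, r i - ∑ i, e i) := by
  rw [Matrix.det_apply']
  refine Ideal.sum_mem _ fun π _ => Ideal.mul_mem_left _ _ ?_
  have h := Ideal.prod_mem_prod (s := Finset.univ) fun i _ => hM (π i) i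
  rw [Finset.prod_pow_eq_pow_sum] at h
  refine Ideal.pow_le_pow_right ?_ h
  rw [← Equiv.sum_comp π r, Nat.sub_le_iff_le_add, ← Finset.sum_add_distrib]
  exact Finset.sum_le_sum fun i _ => by omega

/-- If `a i ∈ I` and the `(i, j)` entry of `C` lies in `Q ^ (d i + 1 - d j)`, then
`det (diag a + C)` is congruent to `∏ i, a i` modulo `Q * I ^ (card ι - 1)`. -/
theorem Matrix.det_diagonal_add_sub_prod_mem {A ι : Type*} [CommRing A] [Fintype ι] [DecidableEq ι]
    {Q I : Ideal A} (hQI : Q ≤ I) (d : ι → ℕ) (a : ι → A) (ha : ∀ i, a i ∈ I)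
    (C : Matrix ι ι A) (hC : ∀ i j, C i j ∈ Q ^ (d i + 1 - d j)) :
    (Matrix.diagonal a + C).det - ∏ i, a i ∈ Q * I ^ (Fintype.card ι - 1) := by
  rw [← Matrix.det_diagonal, Matrix.det_apply', Matrix.det_apply', ← Finset.sum_sub_distrib]
  refine Ideal.sum_mem _ fun π _ => ?_
  rw [← mul_sub]
  refine Ideal.mul_mem_left _ _ ?_
  simp only [Matrix.add_apply]
  rw [Finset.prod_add, ← Finset.add_sum_erase _ _ (Finset.mem_powerset_self Finset.univ)]
  simp only [sdiff_self, Finset.prod_empty, mul_one, Finset.bot_eq_empty, add_sub_cancel_left]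
  refine Ideal.sum_mem _ fun s hs => ?_
  by_cases hfix : ∀ i ∈ s, π i = i
  · have hpos : 0 < (Finset.univ \ s).card :=
      Finset.card_pos.2 (Finset.sdiff_nonempty.2 fun h =>
        (Finset.mem_erase.1 hs).1 (Finset.univ_subset_iff.1 h))
    have hcard : (Finset.univ \ s).card + s.card = Fintype.card ι :=
      Finset.card_sdiff_add_card_eq_card (Finset.subset_univ s)
    have hD : ∏ i ∈ s, Matrix.diagonal a (π i) i ∈ I ^ s.card := by
      have h := Ideal.prod_mem_prod (s := s) (I := fun _ => I)
        (x := fun i => Matrix.diagonal a (π i) i) fun i hi => by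
          rw [hfix i hi, Matrix.diagonal_apply_eq]
          exact ha i
      rwa [Finset.prod_const] at h
    have hCs : ∏ i ∈ Finset.univ \ s, C (π i) i ∈ Q ^ (Finset.univ \ s).card := by
      have h := Ideal.prod_mem_prod (s := Finset.univ \ s) fun i _ => hC (π i) i
      rw [Finset.prod_pow_eq_pow_sum] at h
      refine Ideal.pow_le_pow_right ?_ h
      have h1 : ∑ i ∈ Finset.univ \ s, d (π i) = ∑ i ∈ Finset.univ \ s, d i := by
        have h2 := Finset.sum_sdiff (f := fun i => d (π i)) (Finset.subset_univ s)
        rw [Equiv.sum_comp π d, ← Finset.sum_sdiff (f := d) (Finset.subset_univ s),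
          Finset.sum_congr rfl fun i hi => congrArg d (hfix i hi)] at h2
        exact Nat.add_right_cancel h2
      have h3 : ∑ i ∈ Finset.univ \ s, (d (π i) + 1) ≤
          ∑ i ∈ Finset.univ \ s, ((d (π i) + 1 - d i) + d i) :=
        Finset.sum_le_sum fun i _ => by omega
      rw [Finset.sum_add_distrib, Finset.sum_add_distrib, h1, Finset.sum_const, smul_eq_mul,
        mul_one] at h3
      omega
    have hle : I ^ s.card * Q ^ (Finset.univ \ s).card ≤ Q * I ^ (Fintype.card ι - 1) := by
      obtain ⟨m, hm⟩ := Nat.exists_eq_add_of_lt hpos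
      rw [zero_add] at hm
      have hv : Fintype.card ι - 1 = m + s.card := by omega
      rw [hm, hv, pow_succ', pow_add, mul_left_comm, mul_comm (I ^ s.card)]
      exact Ideal.mul_mono_right (Ideal.mul_mono_left (Ideal.pow_right_mono hQI m))
    exact hle (Ideal.mul_mem_mul hD hCs)
  · push Not at hfix
    obtain ⟨i, hi, hne⟩ := hfix
    have hzero : ∏ i ∈ s, Matrix.diagonal a (π i) i = 0 :=
      Finset.prod_eq_zero hi (Matrix.diagonal_apply_ne a hne)
    rw [hzero, zero_mul]
    exact Ideal.zero_mem _

/-- Graded form of the determinant trick: Cramer's rule for a system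
`a i * x i = b i + ∑ j, C i j * x j` whose coefficients are weighted by the degrees `d`. -/
theorem Ideal.exists_prod_sub_mul_mem_pow {A ι : Type*} [CommRing A] [Fintype ι]
    {Q I : Ideal A} (hQI : Q ≤ I) (d : ι → ℕ) (x a : ι → A) (ha : ∀ i, a i ∈ I)
    (hx : ∀ i, a i * x i ∈ I ^ (d i + 1) ⊔ ⨆ j, Q ^ (d i + 1 - d j) * Ideal.span {x j}) :
    ∃ σ ∈ Q * I ^ (Fintype.card ι - 1),
      ∀ i, (∏ j, a j - σ) * x i ∈ I ^ (d i + Fintype.card ι) := by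
  classical
  have hsys : ∀ i, ∃ b ∈ I ^ (d i + 1), ∃ c : ι → A, (∀ j, c j ∈ Q ^ (d i + 1 - d j)) ∧
      b + ∑ j, c j * x j = a i * x i := by
    intro i
    obtain ⟨b, hb, y, hy, hby⟩ := Submodule.mem_sup.1 (hx i)
    obtain ⟨f, hf, rfl⟩ := (Submodule.mem_iSup_iff_exists_finsupp _ y).1 hy
    choose c hc hcf using fun j => Ideal.mem_mul_span_singleton.1 (hf j)
    refine ⟨b, hb, c, hc, ?_⟩
    rw [← hby, Finsupp.sum_fintype _ _ fun _ => rfl]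
    simp only [hcf]
  choose b hb c hc hbc using hsys
  set C : Matrix ι ι A := fun i j => - c i j with hCdef
  have hC : ∀ i j, C i j ∈ Q ^ (d i + 1 - d j) := fun i j => neg_mem (hc i j)
  set M := Matrix.diagonal a + C with hMdef
  have hMI : ∀ i j, M i j ∈ I ^ (d i + 1 - d j) := by
    intro i j
    refine add_mem ?_ (Ideal.pow_right_mono hQI _ (hC i j))
    by_cases hij : i = j
    · subst hij
      rw [Matrix.diagonal_apply_eq, Nat.add_sub_cancel_left, pow_one]
      exact ha i
    · rw [Matrix.diagonal_apply_ne a hij]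
      exact Ideal.zero_mem _
  have hMx : M.mulVec x = b := by
    ext i
    rw [hMdef, Matrix.add_mulVec, Pi.add_apply, Matrix.mulVec_diagonal, ← hbc i]
    simp [hCdef, Matrix.mulVec, dotProduct]
  refine ⟨∏ j, a j - M.det, ?_, fun i => ?_⟩
  · rw [← neg_sub]
    exact neg_mem (Matrix.det_diagonal_add_sub_prod_mem hQI d a ha C hC)
  · have hcr : M.det * x i = (M.updateCol i b).det := by
      have h := congrFun (congrArg (Matrix.mulVec M.adjugate) hMx) i
      rw [Matrix.mulVec_mulVec, Matrix.adjugate_mul, Matrix.smul_mulVec, Matrix.one_mulVec,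
        ← Matrix.cramer_eq_adjugate_mulVec, Matrix.cramer_apply] at h
      simpa using h
    rw [sub_sub_cancel, hcr]
    have h := Matrix.det_mem_ideal_pow I (M.updateCol i b) (fun k => d k + 1)
      (Function.update d i 0) fun k l => by
        by_cases hl : l = i
        · subst hl
          simpa using hb k
        · simpa [hl] using hMI k l
    refine Ideal.pow_le_pow_right ?_ h
    rw [Finset.sum_update_of_mem (Finset.mem_univ i), Finset.sum_add_distrib,
      ← Finset.sum_sdiff (f := d) (Finset.subset_univ {i})]
    simp
    omega

/-- **Lemma 2.1.**  Let `A` be a commutative ring and `Q ⊆ I` ideals.  Let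
`J 1, …, J N` be ideals such that, for each `1 ≤ n ≤ N`, `J n` is generated by
`v n` elements and `I·(J n) ⊆ I^(n+1) + ∑_{ℓ=1}^N Q^(n+1−ℓ)·(J ℓ)` (where the
exponent `n+1−ℓ` is truncated at `0`, i.e. `Q^m = A` for `m ≤ 0`; this is
Lean's natural-number subtraction).  Put `v = v 1 + ⋯ + v N` and assume `v > 0`.
Then for any `v` elements `a 1, …, a v` of `I` there is `σ ∈ Q·I^(v−1)` with
`a 1 ⋯ a v − σ ∈ ⋂_{n=1}^N (I^(n+v) : J n)`. -/
theorem det_trick_lemma {A : Type*} [CommRing A] (Q I : Ideal A) (hQI : Q ≤ I)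
    (N : ℕ) (J : ℕ → Ideal A) (v : ℕ → ℕ)
    (hgen : ∀ n ∈ Finset.Icc 1 N,
      ∃ s : Finset A, s.card = v n ∧ J n = Ideal.span (↑s : Set A))
    (hmul : ∀ n ∈ Finset.Icc 1 N,
      I * J n ≤ I ^ (n + 1) + ∑ ℓ ∈ Finset.Icc 1 N, Q ^ (n + 1 - ℓ) * J ℓ)
    (hv : 0 < ∑ n ∈ Finset.Icc 1 N, v n)
    (a : Fin (∑ n ∈ Finset.Icc 1 N, v n) → A) (ha : ∀ i, a i ∈ I) :
    ∃ σ ∈ Q * I ^ ((∑ n ∈ Finset.Icc 1 N, v n) - 1),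
      ∀ n ∈ Finset.Icc 1 N,
        (∏ i, a i) - σ ∈ (I ^ (n + ∑ m ∈ Finset.Icc 1 N, v m)).colon (J n) := by
  classical
  choose! s hcard hspan using hgen
  let ι := (n : Finset.Icc 1 N) × s n
  have hι : Fintype.card ι = ∑ n ∈ Finset.Icc 1 N, v n := by
    rw [Fintype.card_sigma, ← Finset.sum_coe_sort (Finset.Icc 1 N) v]
    exact Finset.sum_congr rfl fun n _ => by rw [Fintype.card_coe, hcard n n.2]
  let e : ι ≃ Fin (∑ n ∈ Finset.Icc 1 N, v n) := Fintype.equivFinOfCardEq hι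
  have hsum : ∀ n, ∑ ℓ ∈ Finset.Icc 1 N, Q ^ (n + 1 - ℓ) * J ℓ ≤
      ⨆ k : ι, Q ^ (n + 1 - k.1) * Ideal.span {(k.2 : A)} := by
    intro n
    rw [Ideal.sum_eq_sup]
    refine Finset.sup_le fun ℓ hℓ => ?_
    rw [hspan ℓ hℓ, Ideal.mul_le]
    intro r hr y hy
    induction hy using Submodule.span_induction with
    | mem y hy =>
      exact Ideal.mem_iSup_of_mem (⟨⟨ℓ, hℓ⟩, ⟨y, hy⟩⟩ : ι)
        (Ideal.mul_mem_mul hr (Ideal.mem_span_singleton_self y))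
    | zero => simp
    | add y z _ _ hy hz => rw [mul_add]; exact add_mem hy hz
    | smul t y _ hy => rw [smul_eq_mul, mul_left_comm]; exact Ideal.mul_mem_left _ t hy
  obtain ⟨σ, hσ, hmem⟩ := Ideal.exists_prod_sub_mul_mem_pow hQI (fun k : ι => (k.1 : ℕ))
    (fun k => (k.2 : A)) (fun k => a (e k)) (fun k => ha (e k)) fun k =>
      sup_le_sup_left (hsum k.1) _ (hmul k.1 k.1.2 (Ideal.mul_mem_mul (ha (e k)) (by
        rw [hspan k.1 k.1.2]
        exact Ideal.subset_span k.2.2)))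
  rw [hι] at hσ
  refine ⟨σ, hσ, fun n hn => ?_⟩
  rw [Submodule.mem_colon]
  intro y hy
  rw [hspan n hn] at hy
  rw [smul_eq_mul]
  induction hy using Submodule.span_induction with
  | mem y hy =>
    have h := hmem ⟨⟨n, hn⟩, ⟨y, hy⟩⟩
    rwa [hι, Equiv.prod_comp e a] at h
  | zero => simp
  | add y z _ _ hy hz => rw [mul_add]; exact add_mem hy hz
  | smul t y _ hy => rw [smul_eq_mul, mul_left_comm]; exact Ideal.mul_mem_left _ t hy
end

section
/- Let A be a commutative ring and Q ⊆ I ⊆ J ideals of A such that J² = Q·J. If J/I is finitely generated as an A-module and generated by v elements, then I^{v+2} = Q·I^{v+1}; in particular r_Q(I) ≤ v + 1. -/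
/-- An ideal containing all products of `n` elements of `I` contains `I ^ n`. -/
theorem Ideal.pow_le_of_forall_prod_mem {A : Type*} [CommRing A] (I : Ideal A) (n : ℕ)
    (L : Ideal A) (h : ∀ a : Fin n → A, (∀ i, a i ∈ I) → ∏ i, a i ∈ L) : I ^ n ≤ L := by
  induction n generalizing L with
  | zero =>
    have h1 : (1 : A) ∈ L := by simpa using h Fin.elim0 (fun i => i.elim0)
    simp [(Ideal.eq_top_iff_one L).2 h1]
  | succ n ih =>
    rw [pow_succ', Ideal.mul_le]
    intro r hr s hs
    have hle : I ^ n ≤ Submodule.comap (LinearMap.mulLeft A r) L := by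
      refine ih _ fun a ha => ?_
      simpa [Fin.prod_univ_succ] using
        h (Fin.cons r a) (fun i => Fin.cases (by simpa using hr) (by simpa using ha) i)
    exact hle hs

theorem Ideal.prod_mem_pow_fin {A : Type*} [CommRing A] (I : Ideal A) {n : ℕ} (f : Fin n → A)
    (hf : ∀ i, f i ∈ I) : ∏ i, f i ∈ I ^ n := by
  simpa using Ideal.prod_mem_prod (s := Finset.univ) (I := fun _ : Fin n => I) fun i _ => hf i

theorem Ideal.prod_sub_prod_mem {A : Type*} [CommRing A] (Q I : Ideal A) {n : ℕ}
    (f g : Fin (n + 1) → A) (hf : ∀ i, f i ∈ I) (hg : ∀ i, g i ∈ I)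
    (hfg : ∀ i, f i - g i ∈ Q) : ∏ i, f i - ∏ i, g i ∈ Q * I ^ n := by
  induction n with
  | zero => simpa using hfg 0
  | succ n ih =>
    rw [Fin.prod_univ_succ f, Fin.prod_univ_succ g]
    have h1 := Ideal.mul_mem_mul (hf 0) (ih (fun i => f i.succ) (fun i => g i.succ)
      (fun i => hf _) (fun i => hg _) (fun i => hfg _))
    have h2 := Ideal.mul_mem_mul (hfg 0)
      (I.prod_mem_pow_fin (fun i => g i.succ) (fun i => hg _))
    rw [mul_left_comm, ← pow_succ'] at h1
    convert add_mem h1 h2 using 1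
    ring

theorem Matrix.det_mem_pow {A : Type*} [CommRing A] (I : Ideal A) {n : ℕ}
    (M : Matrix (Fin n) (Fin n) A) (hM : ∀ i j, M i j ∈ I) : M.det ∈ I ^ n := by
  rw [Matrix.det_apply']
  exact sum_mem fun σ _ => Ideal.mul_mem_left _ _ (I.prod_mem_pow_fin _ fun i => hM _ _)

theorem Matrix.det_sub_det_mem {A : Type*} [CommRing A] (Q I : Ideal A) {n : ℕ}
    (M N : Matrix (Fin (n + 1)) (Fin (n + 1)) A) (hM : ∀ i j, M i j ∈ I)
    (hN : ∀ i j, N i j ∈ I) (hMN : ∀ i j, M i j - N i j ∈ Q) :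
    M.det - N.det ∈ Q * I ^ n := by
  rw [Matrix.det_apply', Matrix.det_apply', ← Finset.sum_sub_distrib]
  refine sum_mem fun σ _ => ?_
  rw [← mul_sub]
  exact Ideal.mul_mem_left _ _
    (Q.prod_sub_prod_mem I _ _ (fun i => hM _ _) (fun i => hN _ _) fun i => hMN _ _)

theorem Matrix.adjugate_mem_pow {A : Type*} [CommRing A] (I : Ideal A) {n : ℕ}
    (M : Matrix (Fin (n + 1)) (Fin (n + 1)) A) (hM : ∀ i j, M i j ∈ I) (i j : Fin (n + 1)) :
    M.adjugate i j ∈ I ^ n := by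
  rw [Matrix.adjugate_fin_succ_eq_det_submatrix]
  exact Ideal.mul_mem_left _ _ (Matrix.det_mem_pow I _ fun _ _ => hM _ _)

/-- If `I ^ 2` and every product of an element of `I` with some `x i` lie in
`Q * I + Q * (x 0, …, x n)`, then a Cramer's rule argument bounds the reduction number of `I`. -/
theorem Ideal.pow_le_mul_pow_of_forall_exists_sum {A : Type*} [CommRing A] (Q I : Ideal A)
    (hQI : Q ≤ I) {n : ℕ} (x : Fin (n + 1) → A)
    (hx : ∀ a ∈ I, ∀ i, ∃ q : Fin (n + 1) → A, (∀ j, q j ∈ Q) ∧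
      a * x i - ∑ j, q j * x j ∈ Q * I)
    (hI : ∀ y ∈ I ^ 2, ∃ q : Fin (n + 1) → A, (∀ j, q j ∈ Q) ∧
      y - ∑ j, q j * x j ∈ Q * I) :
    I ^ (n + 3) ≤ Q * I ^ (n + 2) := by
  have hQpow : ∀ k, I ^ k * (Q * I) = Q * I ^ (k + 1) := fun k => by
    rw [mul_left_comm, ← pow_succ]
  rw [show n + 3 = (n + 1) + 2 from rfl, pow_add, mul_comm, Ideal.mul_le]
  intro y hy z hz
  have hle : I ^ (n + 1) ≤ Submodule.comap (LinearMap.mulLeft A y) (Q * I ^ (n + 2)) := by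
    refine I.pow_le_of_forall_prod_mem _ _ fun a ha => ?_
    rw [Submodule.mem_comap, LinearMap.mulLeft_apply]
    choose q hqQ hq using fun i => hx (a i) (ha i) i
    obtain ⟨p, hpQ, hp⟩ := hI y hy
    set D : Matrix (Fin (n + 1)) (Fin (n + 1)) A := Matrix.diagonal a with hD
    set M : Matrix (Fin (n + 1)) (Fin (n + 1)) A := D - Matrix.of q with hMdef
    have hDI : ∀ i j, D i j ∈ I := fun i j => by
      rw [hD, Matrix.diagonal_apply]
      split_ifs
      exacts [ha i, I.zero_mem]
    have hMI : ∀ i j, M i j ∈ I := fun i j => sub_mem (hDI i j) (hQI (hqQ i j))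
    have hdet : M.det - ∏ i, a i ∈ Q * I ^ n := by
      rw [← Matrix.det_diagonal]
      refine Matrix.det_sub_det_mem Q I M D hMI hDI fun i j => ?_
      simpa [hMdef] using hqQ i j
    have hMx : ∀ i, M.mulVec x i ∈ Q * I := fun i => by
      rw [hMdef, hD, Matrix.sub_mulVec, Pi.sub_apply, Matrix.mulVec_diagonal]
      exact hq i
    have hcramer : ∀ i, M.det * x i ∈ Q * I ^ (n + 1) := fun i => by
      have h : M.adjugate.mulVec (M.mulVec x) i = M.det * x i := by
        simp [Matrix.mulVec_mulVec, Matrix.adjugate_mul, Matrix.smul_mulVec]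
      rw [← h, ← hQpow]
      change ∑ j, M.adjugate i j * M.mulVec x j ∈ _
      exact _root_.sum_mem fun j _ => Ideal.mul_mem_mul (Matrix.adjugate_mem_pow I M hMI i j) (hMx j)
    have h1 : y * (M.det - ∏ i, a i) ∈ Q * I ^ (n + 2) := by
      have h := Ideal.mul_mem_mul hdet hy
      rwa [mul_assoc Q, ← pow_add, mul_comm _ y] at h
    have h2 : M.det * (y - ∑ j, p j * x j) ∈ Q * I ^ (n + 2) := by
      rw [← hQpow]
      exact Ideal.mul_mem_mul (Matrix.det_mem_pow I M hMI) hp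
    have h3 : ∑ j, p j * (M.det * x j) ∈ Q * I ^ (n + 2) := by
      refine _root_.sum_mem fun j _ => ?_
      have h := Ideal.mul_mem_mul (hQI (hpQ j)) (hcramer j)
      rwa [mul_left_comm, ← pow_succ'] at h
    have h4 : ∑ j, p j * (M.det * x j) = M.det * ∑ j, p j * x j := by
      rw [Finset.mul_sum]
      exact Finset.sum_congr rfl fun j _ => mul_left_comm _ _ _
    rw [h4] at h3
    convert sub_mem (add_mem h2 h3) h1 using 1
    ring
  exact hle hz

/-- **Corollary 3.1.**  Let `A` be a commutative ring and `Q ⊆ I ⊆ J` ideals with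
`J² = Q·J`.  If `J/I` is generated by `v` elements as an `A`-module (i.e. there is
a finite set `s` of cardinality `v` with `J = I + span s`), then
`I^(v+2) = Q·I^(v+1)`; in particular `r_Q(I) ≤ v + 1`. -/
theorem reduction_number_le_of_sq_eq {A : Type*} [CommRing A] (Q I J : Ideal A)
    (hQI : Q ≤ I) (hIJ : I ≤ J) (hJ : J ^ 2 = Q * J) (v : ℕ)
    (hgen : ∃ s : Finset A, s.card = v ∧ J = I + Ideal.span (↑s : Set A)) :
    I ^ (v + 2) = Q * I ^ (v + 1) ∧ redNum Q I ≤ (v + 1 : ℕ) := by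
  suffices h : I ^ (v + 2) = Q * I ^ (v + 1) from ⟨h, sInf_le ⟨v + 1, rfl, h⟩⟩
  refine le_antisymm ?_ (by rw [pow_succ' I (v + 1)]; exact Ideal.mul_mono_left hQI)
  obtain ⟨s, hs, hJs⟩ := hgen
  cases v with
  | zero =>
    obtain rfl := Finset.card_eq_zero.1 hs
    have hJI : J = I := by simpa using hJs
    rw [hJI] at hJ
    simpa using hJ.le
  | succ n =>
    let x : Fin (n + 1) → A := fun i => ((s.equivFinOfCardEq hs).symm i : A)
    have hrange : Set.range x = (s : Set A) := by
      change Set.range (Subtype.val ∘ (s.equivFinOfCardEq hs).symm) = _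
      rw [(s.equivFinOfCardEq hs).symm.surjective.range_comp]
      simp
    have hxJ : ∀ i, x i ∈ J := fun i => by
      rw [hJs, ← hrange]
      exact Ideal.mem_sup_right (Ideal.subset_span ⟨i, rfl⟩)
    have hJ2 : ∀ y ∈ J ^ 2, ∃ q : Fin (n + 1) → A, (∀ j, q j ∈ Q) ∧
        y - ∑ j, q j * x j ∈ Q * I := fun y hy => by
      rw [hJ, hJs, ← hrange, mul_add] at hy
      obtain ⟨u, hu, w, hw, rfl⟩ := Submodule.mem_sup.1 hy
      obtain ⟨q, hq, rfl⟩ := (Submodule.mem_ideal_smul_span_iff_exists_sum Q x w).1 hw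
      refine ⟨q, hq, ?_⟩
      rw [Finsupp.sum_fintype _ _ (by simp)]
      simpa using hu
    refine Q.pow_le_mul_pow_of_forall_exists_sum I hQI x (fun a ha i => hJ2 _ ?_)
      fun y hy => hJ2 y (Ideal.pow_right_mono hIJ 2 hy)
    rw [pow_two]
    exact Ideal.mul_mem_mul (hIJ ha) (hxJ i)
end

section
/- Let (A, 𝔪) be a two-dimensional regular local ring with infinite residue field A/𝔪, let I be an 𝔪-primary ideal of A, and let Q be a minimal reduction of I. Then r_Q(I) ≤ μ_A(Ī/I) + 1, where Ī denotes the integral closure of the ideal I. -/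
open IsLocalRing

/-- `Q` is a reduction of `I`: `Q ⊆ I` and `I^(n+1) = Q·I^n` for some `n`. -/
def IsReduction {A : Type*} [CommRing A] (Q I : Ideal A) : Prop :=
  Q ≤ I ∧ ∃ n : ℕ, I ^ (n + 1) = Q * I ^ n

/-- `Q` is a minimal reduction of `I`: a reduction minimal with respect to inclusion. -/
def IsMinimalReduction {A : Type*} [CommRing A] (Q I : Ideal A) : Prop :=
  IsReduction Q I ∧ ∀ Q' : Ideal A, Q' ≤ Q → IsReduction Q' I → Q' = Q

/-- The integral closure of an ideal `I`: the set of all `x` satisfying an equation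
`x^m + c 1 * x^(m-1) + ⋯ + c m = 0` with `c i ∈ I^i`. -/
def idealIC {A : Type*} [CommRing A] (I : Ideal A) : Set A :=
  {x | ∃ m : ℕ, 0 < m ∧ ∃ c : ℕ → A, (∀ i ∈ Finset.Icc 1 m, c i ∈ I ^ i) ∧
    x ^ m + ∑ i ∈ Finset.Icc 1 m, c i * x ^ (m - i) = 0}

namespace Ideal

variable {A : Type*} [CommRing A]

/-- Two products of elements of `I` whose factors agree modulo `Q ≤ I` agree modulo
`Q * I ^ (n - 1)`;
multiplying by a further `w ∈ I` avoids the truncated exponent. -/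
lemma prod_sub_prod_mul_mem {ι : Type*} {I Q : Ideal A} (t : Finset ι) {u v : ι → A}
    (hu : ∀ i, u i ∈ I) (hv : ∀ i, v i ∈ I) (huv : ∀ i, u i - v i ∈ Q) {w : A} (hw : w ∈ I) :
    (∏ i ∈ t, u i - ∏ i ∈ t, v i) * w ∈ Q * I ^ t.card := by
  classical
  induction t using Finset.induction_on generalizing w with
  | empty => simp
  | insert a t ha ih =>
    rw [Finset.prod_insert ha, Finset.prod_insert ha, Finset.card_insert_of_notMem ha]
    have hprod : ∏ i ∈ t, v i ∈ I ^ t.card := by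
      simpa using Ideal.prod_mem_prod (s := t) (I := fun _ => I) (x := v) fun i _ => hv i
    have h1 : (∏ i ∈ t, u i - ∏ i ∈ t, v i) * w * u a ∈ Q * I ^ t.card * I :=
      mul_mem_mul (ih hw) (hu a)
    have h2 : (u a - v a) * ((∏ i ∈ t, v i) * w) ∈ Q * (I ^ t.card * I) := by
      exact mul_mem_mul (huv a) (mul_mem_mul hprod hw)
    rw [mul_assoc, ← pow_succ] at h1
    rw [← pow_succ] at h2
    convert add_mem h1 h2 using 1
    ring

/-- The determinant of a matrix with entries in `I` that is diagonal modulo `Q ≤ I`. -/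
lemma det_sub_prod_diag_mul_mem {ι : Type*} [Fintype ι] [DecidableEq ι] {I Q : Ideal A}
    {D : Matrix ι ι A} {y : ι → A} (hy : ∀ i, y i ∈ I) (hQ : Q ≤ I)
    (hD : ∀ i j, D i j - Matrix.diagonal y i j ∈ Q) {w : A} (hw : w ∈ I) :
    (D.det - ∏ i, y i) * w ∈ Q * I ^ Fintype.card ι := by
  have hdiag : ∀ i j, Matrix.diagonal y i j ∈ I := fun i j => by
    by_cases h : i = j
    · subst h; simpa using hy i
    · simp [Matrix.diagonal_apply_ne _ h]
  have hDI : ∀ i j, D i j ∈ I := fun i j => by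
    simpa using add_mem (hQ (hD i j)) (hdiag i j)
  rw [← Matrix.det_diagonal, Matrix.det_apply', Matrix.det_apply', ← Finset.sum_sub_distrib,
    Finset.sum_mul]
  refine _root_.sum_mem fun σ _ => ?_
  rw [← mul_sub, mul_assoc]
  exact mul_mem_left _ _ (prod_sub_prod_mul_mem Finset.univ (fun i => hDI _ _)
    (fun i => hdiag _ _) (fun i => hD _ _) hw)

/-- If `D` has entries in `I` and `D x` has entries in `I ^ 2`, then `det D` multiplies each `x j`
into `I ^ (n + 1)`. -/
lemma det_mul_mem_pow {ι : Type*} [Fintype ι] [DecidableEq ι] {I : Ideal A}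
    {D : Matrix ι ι A} (hD : ∀ i j, D i j ∈ I) {x : ι → A} (hx : ∀ i, D.mulVec x i ∈ I ^ 2)
    (j : ι) : D.det * x j ∈ I ^ (Fintype.card ι + 1) := by
  have h : D.det * x j = D.cramer (D.mulVec x) j := by
    rw [Matrix.cramer_eq_adjugate_mulVec, Matrix.mulVec_mulVec, Matrix.adjugate_mul,
      Matrix.smul_mulVec, Matrix.one_mulVec]
    simp
  rw [h, Matrix.cramer_apply, Matrix.det_apply']
  refine _root_.sum_mem fun σ _ => mul_mem_left _ _ ?_
  have hle : ∏ i : ι, I ^ (if i = j then 2 else 1) = I ^ (Fintype.card ι + 1) := by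
    rw [Finset.prod_pow_eq_pow_sum]
    congr 1
    have : ∀ i : ι, (if i = j then 2 else 1) = 1 + if i = j then 1 else 0 := fun i => by
      split_ifs <;> rfl
    simp [this, Finset.sum_add_distrib]
  rw [← hle]
  refine prod_mem_prod fun i _ => ?_
  by_cases hij : i = j
  · subst hij
    simpa using hx _
  · simpa [hij, Matrix.updateCol_ne hij] using hD _ _

/-- If `J = I + (x_1, …, x_n)` satisfies `J ^ 2 = Q J` for some `Q ≤ I`, then
`I ^ (n + 2) = Q I ^ (n + 1)`. -/
lemma pow_card_add_two_le {I Q J : Ideal A} (hQ : Q ≤ I) (hJ : J * J ≤ Q * J) (s : Finset A)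
    (hs : J = I ⊔ span (s : Set A)) : I ^ (s.card + 2) ≤ Q * I ^ (s.card + 1) := by
  classical
  have hIJ : I ≤ J := hs ▸ le_sup_left
  have hsJ : ∀ i : s, (i : A) ∈ J := fun i =>
    hs ▸ mem_sup_right (subset_span i.2)
  have key : ∀ y : s → A, (∀ i, y i ∈ I) → ∀ w ∈ I ^ 2,
      (∏ i, y i) * w ∈ Q * I ^ (s.card + 1) := by
    intro y hy w hw
    have hrow : ∀ i : s, ∃ q : s → A, (∀ j, q j ∈ Q) ∧
        y i * i - ∑ j, q j * j ∈ I ^ 2 := by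
      intro i
      have h1 : y i * i ∈ Q * I ⊔ Q * span (s : Set A) := by
        rw [← mul_sup, ← hs]
        exact hJ (mul_mem_mul (hIJ (hy i)) (hsJ i))
      obtain ⟨e, he, f, hf, hef⟩ := Submodule.mem_sup.1 h1
      have hf' : ∃ q : s → A, (∀ j, q j ∈ Q) ∧ ∑ j, q j * j = f := by
        rw [← smul_eq_mul, ← Subtype.range_coe (s := (s : Set A)),
          Submodule.mem_ideal_smul_span_iff_exists_sum] at hf
        obtain ⟨a, ha, rfl⟩ := hf
        refine ⟨fun j => a j, ha, ?_⟩
        rw [Finsupp.sum_fintype _ _ (by simp)]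
        simp
      obtain ⟨q, hq, rfl⟩ := hf'
      refine ⟨q, hq, ?_⟩
      rw [← hef, add_sub_cancel_right, pow_two]
      exact mul_mono_left hQ he
    choose q hq hqe using hrow
    set D : Matrix s s A := Matrix.diagonal y - Matrix.of q with hDdef
    have hDQ : ∀ i j, D i j - Matrix.diagonal y i j ∈ Q := fun i j => by
      simpa [hDdef] using hq i j
    have hDI : ∀ i j, D i j ∈ I := fun i j => by
      have : Matrix.diagonal y i j ∈ I := by
        by_cases h : i = j
        · subst h; simpa using hy i
        · simp [Matrix.diagonal_apply_ne _ h]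
      simpa using add_mem (hQ (hDQ i j)) this
    have hDx : ∀ i, D.mulVec (fun j : s => (j : A)) i ∈ I ^ 2 := fun i => by
      have : D.mulVec (fun j : s => (j : A)) i = y i * i - ∑ j, q i j * j := by
        rw [hDdef, Matrix.sub_mulVec, Pi.sub_apply, Matrix.mulVec_diagonal]
        simp [Matrix.mulVec, dotProduct]
      rw [this]
      exact hqe i
    have hcard : Fintype.card s = s.card := Fintype.card_coe s
    have hdetI : D.det ∈ I ^ s.card := by
      rw [Matrix.det_apply']
      refine _root_.sum_mem fun σ _ => mul_mem_left _ _ ?_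
      simpa using prod_mem_prod (s := Finset.univ) (I := fun _ : s => I) (x := fun i => D (σ i) i)
        fun i _ => hDI _ _
    have hdetJ : span {D.det} * J ≤ I ^ (s.card + 1) := by
      rw [hs, mul_sup]
      refine sup_le ?_ ?_
      · rw [pow_succ]
        exact mul_mono_left ((span_singleton_le_iff_mem _).2 hdetI)
      · rw [span_singleton_mul_le_iff]
        intro z hz
        refine Submodule.span_induction (p := fun z _ => D.det * z ∈ I ^ (s.card + 1))
          ?_ ?_ ?_ ?_ hz
        · intro z hz
          have := det_mul_mem_pow hDI hDx ⟨z, hz⟩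
          rwa [hcard] at this
        · simp
        · intro a b _ _ ha hb
          rw [mul_add]; exact add_mem ha hb
        · intro a b _ hb
          rw [smul_eq_mul, mul_left_comm]; exact mul_mem_left _ _ hb
    have h1 : D.det * w ∈ Q * I ^ (s.card + 1) := by
      have hw' : w ∈ Q * J := hJ (mul_mono hIJ hIJ (pow_two I ▸ hw))
      have : D.det * w ∈ span {D.det} * (Q * J) := mul_mem_mul (mem_span_singleton_self _) hw'
      rw [mul_left_comm] at this
      exact mul_mono_right hdetJ this
    have h2 : (D.det - ∏ i, y i) * w ∈ Q * I ^ (s.card + 1) := by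
      rw [pow_two] at hw
      refine Submodule.mul_induction_on hw ?_ ?_
      · intro a ha b hb
        rw [← mul_assoc, pow_succ, ← mul_assoc, ← hcard]
        exact mul_mem_mul (det_sub_prod_diag_mul_mem hy hQ hDQ ha) hb
      · intro a b ha hb
        rw [mul_add]; exact add_mem ha hb
    have := sub_mem h1 h2
    rwa [← sub_mul, sub_sub_cancel] at this
  have hgen : ∀ (n : ℕ) (K L : Ideal A), (∀ y : Fin n → A, (∀ i, y i ∈ I) → ∀ w ∈ K,
      (∏ i, y i) * w ∈ L) → I ^ n * K ≤ L := by
    intro n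
    induction n with
    | zero =>
      intro K L h
      simpa [SetLike.le_def] using h Fin.elim0 (fun i => i.elim0)
    | succ n ih =>
      intro K L h
      rw [pow_succ, mul_assoc]
      refine ih _ _ fun y hy w hw => ?_
      refine Submodule.mul_induction_on hw ?_ ?_
      · intro a ha b hb
        have := h (Fin.snoc y a) (fun i => by
          refine Fin.lastCases ?_ (fun i => ?_) i
          · simpa using ha
          · simpa using hy i) b hb
        rw [Fin.prod_snoc] at this
        rwa [← mul_assoc]
      · intro a b ha hb
        rw [mul_add]; exact add_mem ha hb
  rw [pow_add]
  refine hgen _ _ _ fun y hy w hw => ?_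
  have := key (y ∘ s.equivFin) (fun i => hy _) w hw
  rwa [show ∏ i, (y ∘ s.equivFin) i = ∏ i, y i from Equiv.prod_comp s.equivFin y] at this

variable {A : Type*} [CommRing A]

/-- `I` contains every `z` with `z M ⊆ I M` for some nonzero ideal `M`. -/
def IsMulClosed (I : Ideal A) : Prop :=
  ∀ (z : A) (M : Ideal A), M ≠ ⊥ → span {z} * M ≤ I * M → z ∈ I

/-- The ideal of all `z` with `z M ⊆ I M` for some nonzero ideal `M`. -/
def mulClosure [IsDomain A] (I : Ideal A) : Ideal A where
  carrier := {z | ∃ M : Ideal A, M ≠ ⊥ ∧ span {z} * M ≤ I * M}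
  zero_mem' := ⟨⊤, top_ne_bot, by simp⟩
  add_mem' := by
    rintro a b ⟨M, hM, ha⟩ ⟨N, hN, hb⟩
    refine ⟨M * N, mul_ne_zero hM hN, ?_⟩
    have hle : span {a + b} ≤ span {a} ⊔ span {b} := by
      rw [span_singleton_le_iff_mem]
      exact Submodule.add_mem_sup (mem_span_singleton_self a) (mem_span_singleton_self b)
    refine (mul_mono_left hle).trans ?_
    rw [sup_mul]
    refine sup_le ?_ ?_
    · rw [← mul_assoc, ← mul_assoc]
      exact mul_mono_left ha
    · rw [mul_left_comm, mul_left_comm I]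
      exact mul_mono_right hb
  smul_mem' := by
    rintro c a ⟨M, hM, ha⟩
    refine ⟨M, hM, (mul_mono_left ?_).trans ha⟩
    rw [span_singleton_le_iff_mem, smul_eq_mul]
    exact mul_mem_left _ _ (mem_span_singleton_self a)

lemma le_mulClosure [IsDomain A] (I : Ideal A) : I ≤ I.mulClosure := fun _ hz =>
  ⟨⊤, top_ne_bot, mul_mono_left ((span_singleton_le_iff_mem _).2 hz)⟩

lemma exists_mul_le_of_le_mulClosure [IsDomain A] {I K : Ideal A} (hK : K.FG)
    (h : K ≤ I.mulClosure) : ∃ M : Ideal A, M ≠ ⊥ ∧ K * M ≤ I * M := by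
  induction K, hK using Submodule.fg_induction with
  | singleton z => exact h (mem_span_singleton_self z)
  | sup K L _ _ hK hL =>
    obtain ⟨M, hM, hKM⟩ := hK (le_sup_left.trans h)
    obtain ⟨N, hN, hLN⟩ := hL (le_sup_right.trans h)
    refine ⟨M * N, mul_ne_zero hM hN, ?_⟩
    change (K ⊔ L) * (M * N) ≤ _
    rw [sup_mul]
    refine sup_le ?_ ?_
    · rw [← mul_assoc, ← mul_assoc]
      exact mul_mono_left hKM
    · rw [mul_left_comm, mul_left_comm I]
      exact mul_mono_right hLN

lemma exists_mulClosure_mul_le [IsDomain A] [IsNoetherianRing A] (I : Ideal A) :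
    ∃ M : Ideal A, M ≠ ⊥ ∧ I.mulClosure * M ≤ I * M :=
  exists_mul_le_of_le_mulClosure (IsNoetherian.noetherian _) le_rfl

lemma isMulClosed_mulClosure [IsDomain A] [IsNoetherianRing A] (I : Ideal A) :
    I.mulClosure.IsMulClosed := by
  intro z M hM hz
  obtain ⟨N, hN, hIN⟩ := exists_mulClosure_mul_le I
  refine ⟨M * N, mul_ne_zero hM hN, ?_⟩
  calc span {z} * (M * N) = span {z} * M * N := (mul_assoc _ _ _).symm
    _ ≤ I.mulClosure * M * N := mul_mono_left hz
    _ = I.mulClosure * N * M := mul_right_comm _ _ _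
    _ ≤ I * N * M := mul_mono_left hIN
    _ = I * (M * N) := by rw [mul_assoc, mul_comm N]

lemma sup_pow_succ_le (I K : Ideal A) (n : ℕ) :
    (I ⊔ K) ^ (n + 1) ≤ I * (I ⊔ K) ^ n ⊔ K ^ (n + 1) := by
  induction n with
  | zero => simp
  | succ n ih =>
    rw [pow_succ' _ (n + 1)]
    nth_rewrite 1 [sup_mul]
    refine sup_le le_sup_left ((mul_mono_right ih).trans ?_)
    rw [mul_sup, ← pow_succ']
    refine sup_le_sup_right ?_ _
    rw [mul_left_comm, pow_succ']
    exact mul_mono_right (mul_mono_left le_sup_right)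

lemma coe_mulClosure [IsDomain A] [IsNoetherianRing A] {I : Ideal A} (hI : I ≠ ⊥) :
    (I.mulClosure : Set A) = idealIC I := by
  ext z
  constructor
  · rintro ⟨M, hM, hz⟩
    obtain ⟨p, hp, -, hpI, hp0⟩ :=
      LinearMap.exists_monic_and_natDegree_eq_and_coeff_mem_pow_and_aeval_eq_zero A
        (algebraMap A (Module.End A M) z) I (by
          rintro _ ⟨u, rfl⟩
          have h1 : z * u ∈ I • M := hz (mul_mem_mul (mem_span_singleton_self z) u.2)
          have h2 : I • M = (I • (⊤ : Submodule A M)).map M.subtype := by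
            rw [Submodule.map_smul'', Submodule.map_subtype_top]
          rw [h2] at h1
          obtain ⟨v, hv, hvz⟩ := h1
          rwa [show v = algebraMap A (Module.End A M) z u from Subtype.ext hvz] at hv)
    have hpz : p.eval z = 0 := by
      obtain ⟨u, hu, hu0⟩ := Submodule.exists_mem_ne_zero_of_ne_bot hM
      rw [Polynomial.aeval_algebraMap_apply, Polynomial.coe_aeval_eq_eval] at hp0
      have := congrArg Subtype.val (LinearMap.congr_fun hp0 ⟨u, hu⟩)
      simpa [hu0] using this
    have hdeg : 0 < p.natDegree := by
      by_contra h
      rw [not_lt, Nat.le_zero, hp.natDegree_eq_zero] at h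
      simp [h] at hpz
    refine ⟨p.natDegree, hdeg, fun i => p.coeff (p.natDegree - i), fun i hi => ?_, ?_⟩
    · have := hpI (p.natDegree - i)
      rwa [Nat.sub_sub_self (Finset.mem_Icc.1 hi).2] at this
    · rw [Polynomial.eval_eq_sum_range, ← Finset.sum_range_reflect, Finset.sum_range_succ'] at hpz
      rw [← hpz, add_comm, ← Finset.Ico_add_one_right_eq_Icc, Finset.sum_Ico_eq_sum_range]
      simp [hp.leadingCoeff, add_comm 1]
  · rintro ⟨m, hm, c, hc, h⟩
    obtain ⟨n, rfl⟩ := Nat.exists_eq_add_of_lt hm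
    rw [zero_add] at *
    have hL : I ⊔ span {z} ≠ ⊥ := fun h => hI (le_bot_iff.1 (h ▸ le_sup_left))
    refine ⟨(I ⊔ span {z}) ^ n, pow_ne_zero _ hL, ?_⟩
    calc span {z} * (I ⊔ span {z}) ^ n ≤ (I ⊔ span {z}) ^ (n + 1) := by
          rw [pow_succ']; exact mul_mono_left le_sup_right
      _ ≤ I * (I ⊔ span {z}) ^ n ⊔ span {z} ^ (n + 1) := sup_pow_succ_le _ _ _
      _ ≤ I * (I ⊔ span {z}) ^ n := by
          refine sup_le le_rfl ?_
          rw [span_singleton_pow, span_singleton_le_iff_mem, eq_neg_of_add_eq_zero_left h]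
          refine neg_mem (_root_.sum_mem fun i hi => ?_)
          have hi' := Finset.mem_Icc.1 hi
          have h1 := mul_mem_mul (hc i hi)
            (pow_mem_pow (mem_span_singleton_self z) (n + 1 - i))
          refine SetLike.le_def.1 ?_ h1
          obtain ⟨j, rfl⟩ : ∃ j, i = j + 1 := ⟨i - 1, by omega⟩
          rw [pow_succ', mul_assoc]
          refine mul_mono_right ?_
          have : n = j + (n + 1 - (j + 1)) := by omega
          conv_rhs => rw [this, pow_add]
          exact mul_mono (pow_right_mono le_sup_left _) (pow_right_mono le_sup_right _)

variable {A : Type*} [CommRing A]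

lemma exists_span_singleton_mul_eq {M : Ideal A} {g : A} (h : M ≤ span {g}) :
    ∃ M' : Ideal A, span {g} * M' = M := by
  refine ⟨Submodule.comap (LinearMap.mulLeft A g) M, le_antisymm ?_ ?_⟩
  · exact span_singleton_mul_le_iff.2 fun z hz => hz
  · intro z hz
    obtain ⟨w, rfl⟩ := mem_span_singleton'.1 (h hz)
    rw [mul_comm w g] at hz ⊢
    exact mul_mem_mul (mem_span_singleton_self g) (show g * w ∈ M from hz)

/-- A nonzero ideal is a power of a nonunit `x` times an ideal not contained in `(x)`. -/
lemma exists_eq_span_pow_mul [IsDomain A] [IsNoetherianRing A] {x : A} (hx : ¬ IsUnit x)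
    {M : Ideal A} (hM : M ≠ ⊥) :
    ∃ (j : ℕ) (M' : Ideal A), span {x} ^ j * M' = M ∧ ¬ M' ≤ span {x} := by
  classical
  have hex : ∃ n, ¬ M ≤ span {x} ^ n := by
    by_contra! h
    refine hM (le_bot_iff.1 ?_)
    rw [← iInf_pow_eq_bot_of_isDomain (span {x}) (by rwa [Ne, span_singleton_eq_top])]
    exact le_iInf h
  obtain ⟨j, hj⟩ : ∃ j, Nat.find hex = j + 1 := Nat.exists_eq_succ_of_ne_zero fun h => by
    have := Nat.find_spec hex
    simp [h] at this
  have h1 : M ≤ span {x} ^ j := not_not.1 (Nat.find_min hex (by omega))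
  have h2 : ¬ M ≤ span {x} ^ (j + 1) := hj ▸ Nat.find_spec hex
  obtain ⟨M', hM'⟩ := exists_span_singleton_mul_eq
    (by rwa [← span_singleton_pow] : M ≤ span {x ^ j})
  rw [← span_singleton_pow] at hM'
  refine ⟨j, M', hM', fun h => h2 ?_⟩
  rw [← hM', pow_succ]
  exact mul_mono_right h

end Ideal

namespace IsLocalRing

open Ideal

variable {A : Type*} [CommRing A] [IsLocalRing A]

lemma exists_unit_mul_pow [IsNoetherianRing A] {y : A} (hy : maximalIdeal A = span {y}) {u : A}
    (hu : u ≠ 0) : ∃ (w : A) (i : ℕ), IsUnit w ∧ u = w * y ^ i := by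
  classical
  have hex : ∃ n, u ∉ maximalIdeal A ^ n := by
    by_contra! h
    refine hu ?_
    rw [← Submodule.mem_bot A, ← iInf_pow_eq_bot_of_isLocalRing (maximalIdeal A)
      (maximalIdeal.isMaximal A).ne_top]
    exact (Submodule.mem_iInf _).2 h
  obtain ⟨j, hj⟩ : ∃ j, Nat.find hex = j + 1 := Nat.exists_eq_succ_of_ne_zero fun h => by
    have := Nat.find_spec hex
    simp [h] at this
  have h1 : u ∈ maximalIdeal A ^ j := not_not.1 (Nat.find_min hex (by omega))
  have h2 : u ∉ maximalIdeal A ^ (j + 1) := hj ▸ Nat.find_spec hex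
  rw [hy, span_singleton_pow] at h1 h2
  obtain ⟨w, rfl⟩ := mem_span_singleton'.1 h1
  refine ⟨w, j, ?_, rfl⟩
  by_contra hw
  rw [← mem_nonunits_iff, ← mem_maximalIdeal, hy] at hw
  obtain ⟨v, rfl⟩ := mem_span_singleton'.1 hw
  exact h2 (mem_span_singleton'.2 ⟨v, by ring⟩)

/-- A Noetherian local ring whose maximal ideal is generated by a non-nilpotent element
is a domain. -/
lemma isDomain_of_maximalIdeal_eq_span [IsNoetherianRing A] {y : A}
    (hy : maximalIdeal A = span {y}) (hn : ¬ IsNilpotent y) : IsDomain A := by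
  have : NoZeroDivisors A := ⟨by
    intro a b hab
    by_contra! h
    obtain ⟨u, i, hu, rfl⟩ := exists_unit_mul_pow hy h.1
    obtain ⟨v, j, hv, rfl⟩ := exists_unit_mul_pow hy h.2
    refine hn ⟨i + j, ?_⟩
    rw [mul_mul_mul_comm, ← pow_add] at hab
    exact ((hu.mul hv).mul_right_eq_zero).1 hab⟩
  exact NoZeroDivisors.to_isDomain A

/-- `x, y` generate the maximal ideal, `x` is prime and does not divide `y`. -/
structure IsRegularPair (x y : A) : Prop where
  span_eq : maximalIdeal A = span {x, y}
  prime : Prime x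
  not_dvd : ¬ x ∣ y

lemma not_pow_mem_of_height [IsNoetherianRing A] {x y : A} (h : maximalIdeal A = span {x, y})
    (ht : 1 < (maximalIdeal A).height) (n : ℕ) : y ^ n ∉ span {x} := by
  intro hn
  refine ht.not_ge (height_le_one_of_isPrincipal_of_mem_minimalPrimes (span {x}) _
    ⟨⟨inferInstance, ?_⟩, ?_⟩)
  · rw [h]; exact span_mono (by simp)
  · rintro p ⟨hp, hxp⟩ -
    rw [h, span_le]
    rintro z (rfl | rfl)
    · exact hxp (mem_span_singleton_self z)
    · exact hp.mem_of_pow_mem n (hxp hn)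

lemma isPrime_span_singleton_of_height [IsNoetherianRing A] {x y : A}
    (h : maximalIdeal A = span {x, y}) (ht : 1 < (maximalIdeal A).height) :
    (span {x}).IsPrime := by
  have hxm : span {x} ≤ maximalIdeal A := by rw [h]; exact span_mono (by simp)
  have hne : span {x} ≠ ⊤ := fun h => (maximalIdeal.isMaximal A).ne_top (top_le_iff.1 (h ▸ hxm))
  have : Nontrivial (A ⧸ span {x}) := Quotient.nontrivial_iff.2 hne
  have : IsLocalRing (A ⧸ span {x}) := .of_surjective' _ Ideal.Quotient.mk_surjective
  have hmax : maximalIdeal (A ⧸ span {x}) = span {Ideal.Quotient.mk _ y} := by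
    rw [← map_maximalIdeal_of_surjective _ (Ideal.Quotient.mk_surjective (I := span {x})), h,
      map_span]
    simp [Set.image_pair]
  have := isDomain_of_maximalIdeal_eq_span hmax (by
    rintro ⟨n, hn⟩
    rw [← map_pow, Ideal.Quotient.eq_zero_iff_mem] at hn
    exact not_pow_mem_of_height h ht n hn)
  exact (Ideal.Quotient.isDomain_iff_prime _).1 this

lemma IsRegularPair.of_height [IsDomain A] [IsNoetherianRing A] {x y : A}
    (h : maximalIdeal A = span {x, y}) (ht : 1 < (maximalIdeal A).height) :
    IsRegularPair x y := by
  have hx : x ≠ 0 := by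
    rintro rfl
    refine ht.not_ge (height_le_one_of_isPrincipal_of_mem_minimalPrimes (span {y}) _
      ⟨⟨inferInstance, ?_⟩, ?_⟩)
    · rw [h]; exact span_mono (by simp)
    · rintro p ⟨hp, hyp⟩ -
      rw [h, span_le]
      rintro z (rfl | rfl)
      · exact p.zero_mem
      · exact hyp (mem_span_singleton_self z)
  refine ⟨h, (span_singleton_prime hx).1 (isPrime_span_singleton_of_height h ht), fun hd => ?_⟩
  exact not_pow_mem_of_height h ht 1 (by rwa [pow_one, mem_span_singleton])

namespace IsRegularPair

variable {x y : A} (h : IsRegularPair x y)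
include h

lemma left_mem : x ∈ maximalIdeal A := h.span_eq ▸ subset_span (by simp)

lemma right_mem : y ∈ maximalIdeal A := h.span_eq ▸ subset_span (by simp)

lemma pow_succ_le (k : ℕ) :
    maximalIdeal A ^ (k + 1) ≤ span {x} * maximalIdeal A ^ k ⊔ span {y ^ (k + 1)} := by
  rw [h.span_eq, span_insert, ← span_singleton_pow]
  exact sup_pow_succ_le _ _ _

lemma mem_pow_succ {k : ℕ} {z : A} (hz : z ∈ maximalIdeal A ^ (k + 1)) :
    ∃ g ∈ maximalIdeal A ^ k, ∃ c, z = x * g + c * y ^ (k + 1) := by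
  obtain ⟨u, hu, v, hv, rfl⟩ := Submodule.mem_sup.1 (h.pow_succ_le k hz)
  obtain ⟨g, hg, rfl⟩ := mem_span_singleton_mul.1 hu
  obtain ⟨c, rfl⟩ := mem_span_singleton'.1 hv
  exact ⟨g, hg, c, rfl⟩

lemma mem_of_mul_mem [IsDomain A] {k : ℕ} {b : A} (hb : x * b ∈ maximalIdeal A ^ (k + 1)) :
    b ∈ maximalIdeal A ^ k := by
  obtain ⟨g, hg, c, hc⟩ := h.mem_pow_succ hb
  have h1 : x ∣ c * y ^ (k + 1) := ⟨b - g, by rw [mul_sub, hc]; ring⟩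
  obtain ⟨d, rfl⟩ := (h.prime.dvd_or_dvd h1).resolve_right
    fun h2 => h.not_dvd (h.prime.dvd_of_dvd_pow h2)
  have : b = g + d * y * y ^ k := mul_left_cancel₀ h.prime.ne_zero (by rw [hc]; ring)
  rw [this]
  exact add_mem hg (mul_mem_left _ _ (pow_mem_pow h.right_mem k))

lemma mem_of_pow_mul_mem [IsDomain A] {k j : ℕ} {b : A}
    (hb : x ^ j * b ∈ maximalIdeal A ^ (k + j)) : b ∈ maximalIdeal A ^ k := by
  induction j with
  | zero => simpa using hb
  | succ j ih =>
    refine ih (h.mem_of_mul_mem ?_)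
    rwa [← mul_assoc, ← pow_succ']

lemma mem_of_mul_pow_mem {k : ℕ} {c g : A} (hc : x * g + c * y ^ k ∈ maximalIdeal A ^ (k + 1)) :
    c ∈ maximalIdeal A := by
  obtain ⟨g', -, d, hd⟩ := h.mem_pow_succ hc
  by_contra hcu
  have hu : IsUnit (c - d * y) := by
    by_contra hn
    refine hcu ?_
    have := add_mem ((mem_maximalIdeal _).2 hn) (mul_mem_left _ d h.right_mem)
    rwa [sub_add_cancel] at this
  have h1 : x ∣ (c - d * y) * y ^ k := ⟨g' - g, by linear_combination hd⟩
  rcases h.prime.dvd_or_dvd h1 with h2 | h2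
  · exact h.prime.not_isUnit (isUnit_of_dvd_unit h2 hu)
  · exact h.not_dvd (h.prime.dvd_of_dvd_pow h2)

/-- `x, y` are analytically independent. -/
lemma coeff_mem_of_sum_mem [IsDomain A] {k : ℕ} {p : ℕ → A}
    (hp : ∑ i ∈ Finset.range (k + 1), p i * (x ^ (k - i) * y ^ i) ∈ maximalIdeal A ^ (k + 1)) :
    ∀ i ≤ k, p i ∈ maximalIdeal A := by
  induction k with
  | zero => simpa using hp
  | succ k ih =>
    have hsum : ∑ i ∈ Finset.range (k + 1), p i * (x ^ (k + 1 - i) * y ^ i) =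
        x * ∑ i ∈ Finset.range (k + 1), p i * (x ^ (k - i) * y ^ i) := by
      rw [Finset.mul_sum]
      refine Finset.sum_congr rfl fun i hi => ?_
      rw [Nat.succ_sub (Finset.mem_range_succ_iff.1 hi), pow_succ]
      ring
    rw [Finset.sum_range_succ, hsum, Nat.sub_self, pow_zero, one_mul] at hp
    have h1 := h.mem_of_mul_pow_mem hp
    have h2 := h.mem_of_mul_mem ((Submodule.add_mem_iff_left _ (by
      rw [pow_succ' _ (k + 1)]
      exact mul_mem_mul h1 (pow_mem_pow h.right_mem _))).1 hp)
    intro i hi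
    rcases Nat.le_succ_iff.1 hi with hi | rfl
    · exact ih h2 i hi
    · exact h1

lemma exists_polynomial {r : ℕ} {f : A} (hf : f ∈ maximalIdeal A ^ r) :
    ∃ p : Polynomial A, (∀ c, x - c * y ∣ f - p.eval c * y ^ r) ∧
      ((∀ i, p.coeff i ∈ maximalIdeal A) → f ∈ maximalIdeal A ^ (r + 1)) := by
  induction r generalizing f with
  | zero => exact ⟨.C f, by simp, fun hc => by simpa using hc 0⟩
  | succ r ih =>
    obtain ⟨g, hg, c₀, rfl⟩ := h.mem_pow_succ hf
    obtain ⟨p, hp, hp'⟩ := ih hg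
    refine ⟨.X * p + .C c₀, fun c => ?_, fun hc => ?_⟩
    · obtain ⟨d, hd⟩ := hp c
      refine ⟨g + c * y * d, ?_⟩
      simp only [Polynomial.eval_add, Polynomial.eval_mul, Polynomial.eval_X, Polynomial.eval_C]
      linear_combination c * y * hd
    · have h0 : c₀ ∈ maximalIdeal A := by simpa using hc 0
      have h1 : g ∈ maximalIdeal A ^ (r + 1) := hp' fun i => by
        simpa using hc (i + 1)
      refine add_mem ?_ ?_
      · rw [pow_succ']; exact mul_mem_mul h.left_mem h1
      · rw [pow_succ']; exact mul_mem_mul h0 (pow_mem_pow h.right_mem _)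

/-- For an element `f` of order `r`, a general linear change of the parameters makes `f` regular
of order `r` in the second parameter. -/
lemma exists_general [Infinite (ResidueField A)] {r : ℕ} {f : A}
    (hf : f ∈ maximalIdeal A ^ r) (hf' : f ∉ maximalIdeal A ^ (r + 1)) :
    ∃ c u : A, IsUnit u ∧ x - c * y ∣ f - u * y ^ r := by
  obtain ⟨p, hp, hp'⟩ := h.exists_polynomial hf
  have hne : p.map (residue A) ≠ 0 := by
    intro h0
    refine hf' (hp' fun i => ?_)
    rw [← residue_eq_zero_iff, ← Polynomial.coeff_map, h0, Polynomial.coeff_zero]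
  obtain ⟨c', hc'⟩ : ∃ c', (p.map (residue A)).eval c' ≠ 0 := by
    by_contra! hall
    exact hne (Polynomial.funext fun c => by simpa using hall c)
  obtain ⟨c, rfl⟩ := residue_surjective c'
  refine ⟨c, p.eval c, ?_, hp c⟩
  rw [Polynomial.eval_map_apply, residue_ne_zero_iff_isUnit] at hc'
  exact hc'

/-- If `a` has order `r` and is regular of order `r` in `y`, then
`𝔪 ^ (r + k) = a 𝔪 ^ k + x ^ k 𝔪 ^ r`. -/
lemma pow_add_le [IsDomain A] {r : ℕ} {a u : A} (ha : a ∈ maximalIdeal A ^ r) (hu : IsUnit u)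
    (hau : x ∣ a - u * y ^ r) (k : ℕ) :
    maximalIdeal A ^ (r + k) ≤
      span {a} * maximalIdeal A ^ k ⊔ span {x ^ k} * maximalIdeal A ^ r := by
  have h1 : maximalIdeal A ^ (r + 1) ≤
      span {a} * maximalIdeal A ⊔ span {x} * maximalIdeal A ^ r := by
    refine (h.pow_succ_le r).trans (sup_le le_sup_right ?_)
    rw [span_singleton_le_iff_mem]
    obtain ⟨v, hv⟩ := hu.exists_left_inv
    obtain ⟨g, hg⟩ := hau
    have hyg : y * g ∈ maximalIdeal A ^ r := by
      refine h.mem_of_mul_mem ?_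
      have : x * (y * g) = y * a - u * y ^ (r + 1) := by linear_combination -y * hg
      rw [this]
      refine sub_mem ?_ (mul_mem_left _ _ (pow_mem_pow h.right_mem _))
      rw [pow_succ']
      exact mul_mem_mul h.right_mem ha
    have : y ^ (r + 1) = a * (v * y) + x * (-v * (y * g)) := by
      linear_combination (-y ^ (r + 1)) * hv - v * y * hg
    rw [this]
    exact Submodule.add_mem_sup
      (mul_mem_mul (mem_span_singleton_self a) (mul_mem_left _ _ h.right_mem))
      (mul_mem_mul (mem_span_singleton_self x) (mul_mem_left _ _ hyg))
  induction k with
  | zero => simp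
  | succ k ih =>
    calc maximalIdeal A ^ (r + (k + 1)) = maximalIdeal A ^ (r + 1) * maximalIdeal A ^ k := by ring
      _ ≤ (span {a} * maximalIdeal A ⊔ span {x} * maximalIdeal A ^ r) * maximalIdeal A ^ k :=
        mul_mono_left h1
      _ = span {a} * maximalIdeal A ^ (k + 1) ⊔ span {x} * maximalIdeal A ^ (r + k) := by
        rw [Ideal.sup_mul, mul_assoc, mul_assoc, ← pow_succ', ← pow_add]
      _ ≤ _ := by
        refine sup_le le_sup_left ((mul_mono_right ih).trans ?_)
        rw [Ideal.mul_sup]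
        refine sup_le_sup ?_ ?_
        · rw [mul_left_comm, pow_succ' _ k]
          exact mul_mono_right (mul_mono_left ((span_singleton_le_iff_mem _).2 h.left_mem))
        · rw [← mul_assoc, span_singleton_mul_span_singleton, ← pow_succ']

end IsRegularPair

variable {A : Type*} [CommRing A] [IsLocalRing A]

/-- A Noetherian local ring with infinite residue field whose maximal ideal has height at least two
and is generated by two elements is a domain. -/
lemma isDomain_of_height [IsNoetherianRing A] [Infinite (ResidueField A)] {x y : A}
    (h : maximalIdeal A = span {x, y}) (ht : 1 < (maximalIdeal A).height) : IsDomain A := by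
  have hgen : ∀ c : A, maximalIdeal A = span {x - c * y, y} := by
    intro c
    rw [h]
    refine le_antisymm (span_le.2 ?_) (span_le.2 ?_)
    · rintro z (rfl | rfl)
      · exact mem_span_pair.2 ⟨1, c, by ring⟩
      · exact subset_span (by simp)
    · rintro z (rfl | rfl)
      · exact mem_span_pair.2 ⟨1, -c, by ring⟩
      · exact subset_span (by simp)
  obtain ⟨c, hc⟩ : ∃ c : A, ∀ p ∈ minimalPrimes A, x - c * y ∉ p := by
    by_contra! hall
    choose p hp hxp using hall
    have hfin : (minimalPrimes A).Finite := minimalPrimes.finite_of_isNoetherianRing A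
    obtain ⟨c, hc⟩ : ∃ c : ResidueField A → A, ∀ t, residue A (c t) = t :=
      ⟨_, fun t => (residue_surjective t).choose_spec⟩
    have : Finite (minimalPrimes A) := hfin
    obtain ⟨s, t, hst, hpst⟩ := Finite.exists_ne_map_eq_of_infinite
      (fun t : ResidueField A => (⟨p (c t), hp (c t)⟩ : minimalPrimes A))
    have hpst' : p (c s) = p (c t) := congrArg Subtype.val hpst
    have hprime : (p (c t)).IsPrime := (hp (c t)).1.1
    have hu : IsUnit (c s - c t) := by
      rw [← residue_ne_zero_iff_isUnit, map_sub, hc, hc]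
      exact sub_ne_zero.2 hst
    have h1 : (c s - c t) * y ∈ p (c t) := by
      have := sub_mem (hxp (c t)) (hpst' ▸ hxp (c s))
      convert this using 1
      ring
    have hy : y ∈ p (c t) := (hprime.mem_or_mem h1).resolve_left fun hm =>
      hprime.ne_top (eq_top_of_isUnit_mem _ hm hu)
    have hle : maximalIdeal A ≤ p (c t) := by
      rw [hgen (c t), span_le]
      rintro z (rfl | rfl)
      · exact hxp _
      · exact hy
    have heq : maximalIdeal A = p (c t) := le_antisymm hle (le_maximalIdeal hprime.ne_top)
    have h0 : (maximalIdeal A).height = 0 := by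
      rw [Ideal.height_eq_zero_iff]
      exact heq ▸ hp (c t)
    simp [h0] at ht
  have hprime := isPrime_span_singleton_of_height (hgen c) ht
  obtain ⟨p, hp, hpx⟩ := exists_minimalPrimes_le (I := (⊥ : Ideal A))
    (bot_le : ⊥ ≤ span {x - c * y})
  have hpp : p.IsPrime := hp.1.1
  have hxp := hc p hp
  have hp0 : p = ⊥ := by
    refine Submodule.eq_bot_of_le_smul_of_le_jacobson_bot (maximalIdeal A) p
      (IsNoetherian.noetherian _) ?_ (jacobson_eq_maximalIdeal ⊥ bot_ne_top).ge
    intro z hz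
    obtain ⟨w, rfl⟩ := mem_span_singleton'.1 (hpx hz)
    rw [mul_comm]
    refine mul_mem_mul ?_ ((hpp.mem_or_mem hz).resolve_right hxp)
    rw [hgen c]
    exact subset_span (by simp)
  rw [hp0] at hpp
  exact IsDomain.of_bot_isPrime A

/-- `M ≠ 0` cannot be cancelled by a proper ideal. -/
lemma eq_top_of_top_mul_le [IsNoetherianRing A] {Q M : Ideal A} (hM : M ≠ ⊥) (h : ⊤ * M ≤ Q * M) :
    Q = ⊤ := by
  by_contra hQ
  refine hM (Submodule.eq_bot_of_le_smul_of_le_jacobson_bot Q M (IsNoetherian.noetherian _) ?_ ?_)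
  · simpa using h
  · rw [jacobson_eq_maximalIdeal ⊥ bot_ne_top]
    exact le_maximalIdeal hQ

namespace IsRegularPair

variable [IsDomain A] {x y : A} (h : IsRegularPair x y)
include h

/-- Modulo the prime element `x` the ring is a discrete valuation ring, so integral dependence
becomes containment. -/
lemma le_sup_of_mul_le [IsNoetherianRing A] {I Q M : Ideal A} (hM : M ≠ ⊥) (hIM : I * M ≤ Q * M) :
    I ≤ Q ⊔ span {x} := by
  obtain ⟨j, N, rfl, hN⟩ := exists_eq_span_pow_mul h.prime.not_isUnit hM
  have hIN : I * N ≤ Q * N := by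
    rw [mul_left_comm, mul_left_comm Q, span_singleton_pow] at hIM
    exact (span_singleton_mul_right_mono (pow_ne_zero _ h.prime.ne_zero)).1 hIM
  have hp : (span {x}).IsPrime := (span_singleton_prime h.prime.ne_zero).2 h.prime
  have : IsLocalRing (A ⧸ span {x}) := .of_surjective' _ Ideal.Quotient.mk_surjective
  have hmax : maximalIdeal (A ⧸ span {x}) = span {Ideal.Quotient.mk _ y} := by
    rw [← map_maximalIdeal_of_surjective _ (Ideal.Quotient.mk_surjective (I := span {x})),
      h.span_eq, map_span]
    simp [Set.image_pair]
  have hprin : (maximalIdeal (A ⧸ span {x})).IsPrincipal := ⟨⟨_, hmax⟩⟩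
  have hpir : IsPrincipalIdealRing (A ⧸ span {x}) :=
    ((tfae_of_isNoetherianRing_of_isLocalRing_of_isDomain (A ⧸ span {x})).out 0 4).2 hprin
  have hle := map_mono (f := Ideal.Quotient.mk (span {x})) hIN
  rw [Ideal.map_mul, Ideal.map_mul] at hle
  obtain ⟨g, hg⟩ := (hpir.principal (N.map (Ideal.Quotient.mk (span {x})))).principal
  have hg0 : g ≠ 0 := by
    rintro rfl
    refine hN fun z hz => ?_
    have := mem_map_of_mem (Ideal.Quotient.mk (span {x})) hz
    rw [hg] at this
    simpa [Ideal.Quotient.eq_zero_iff_mem] using this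
  rw [hg, submodule_span_eq, mul_comm, mul_comm _ (span {g}),
    span_singleton_mul_right_mono hg0] at hle
  have h2 := (le_comap_map (I := I)).trans (comap_mono hle)
  rwa [comap_map_of_surjective _ Ideal.Quotient.mk_surjective, ← RingHom.ker_eq_comap_bot,
    mk_ker] at h2

variable {r : ℕ} {I Q : Ideal A} {a u : A}

lemma mem_of_mul_le [IsNoetherianRing A] (hI : I.IsMulClosed) (hIr : I ≤ maximalIdeal A ^ r)
    (ha : a ∈ I) (hu : IsUnit u) (hau : x ∣ a - u * y ^ r) {t : A} (ht : t ∈ maximalIdeal A ^ r)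
    {k : ℕ} {M : Ideal A} (hM : M ≠ ⊥)
    (htM : span {x ^ k} * (span {t} * M) ≤ I * maximalIdeal A ^ k * M) : t ∈ I := by
  have hm : maximalIdeal A ≠ ⊥ := fun h0 => h.prime.ne_zero (by simpa [h0] using h.left_mem)
  refine hI t (maximalIdeal A ^ (r + k) * M) (mul_ne_zero (pow_ne_zero _ hm) hM) ?_
  have h1 := h.pow_add_le (hIr ha) hu hau k
  have hal : span {a} ≤ I := (span_singleton_le_iff_mem _).2 ha
  have htl : span {t} ≤ maximalIdeal A ^ r := (span_singleton_le_iff_mem _).2 ht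
  calc span {t} * (maximalIdeal A ^ (r + k) * M)
      ≤ span {t} * ((span {a} * maximalIdeal A ^ k ⊔ span {x ^ k} * maximalIdeal A ^ r) * M) :=
        mul_mono_right (mul_mono_left h1)
    _ = span {a} * (span {t} * maximalIdeal A ^ k * M) ⊔
        span {x ^ k} * (span {t} * M) * maximalIdeal A ^ r := by
        rw [Ideal.sup_mul, Ideal.mul_sup]; congr 1 <;> ring
    _ ≤ I * (maximalIdeal A ^ r * maximalIdeal A ^ k * M) ⊔
        I * maximalIdeal A ^ k * M * maximalIdeal A ^ r :=
        sup_le_sup (mul_mono hal (mul_mono_left (mul_mono_left htl))) (mul_mono_left htM)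
    _ = I * (maximalIdeal A ^ (r + k) * M) := by
        have : I * maximalIdeal A ^ k * M * maximalIdeal A ^ r =
          I * (maximalIdeal A ^ r * maximalIdeal A ^ k * M) := by ring
        rw [this, sup_idem, pow_add]

/-- An integrally closed ideal is contracted from the quadratic transform. -/
lemma mem_of_pow_mul_mem_mul [IsNoetherianRing A] (hI : I.IsMulClosed)
    (hIr : I ≤ maximalIdeal A ^ r) (ha : a ∈ I) (hu : IsUnit u) (hau : x ∣ a - u * y ^ r)
    {t : A} {k : ℕ} (ht : x ^ k * t ∈ I * maximalIdeal A ^ k) : t ∈ I := by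
  refine h.mem_of_mul_le hI hIr ha hu hau (k := k) (h.mem_of_pow_mul_mem (j := k) ?_)
    (M := ⊤) top_ne_bot ?_
  · rw [pow_add]; exact mul_mono_left hIr ht
  · simpa [span_singleton_mul_span_singleton] using ht

/-- The product of an integrally closed ideal with a reduction is contracted from the quadratic
transform. -/
lemma mem_mul_of_pow_mul_mem_mul [IsNoetherianRing A] (hI : I.IsMulClosed)
    (hIr : I ≤ maximalIdeal A ^ r) (hQI : Q ≤ I) (ha : a ∈ Q) (hu : IsUnit u)
    (hau : x ∣ a - u * y ^ r) {t : A} {k : ℕ} (ht : x ^ k * t ∈ Q * I * maximalIdeal A ^ k) :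
    t ∈ Q * I := by
  have hxa : ¬ x ∣ a := by
    intro hd
    have h1 : x ∣ u * y ^ r := by simpa using dvd_sub hd hau
    rcases h.prime.dvd_or_dvd h1 with h2 | h2
    · exact h.prime.not_isUnit (isUnit_of_dvd_unit h2 hu)
    · exact h.not_dvd (h.prime.dvd_of_dvd_pow h2)
  have hle : Q * (I * maximalIdeal A ^ k) ≤
      span {a} * (I * maximalIdeal A ^ k) ⊔ span {x ^ k} * (Q * I) := by
    rw [mul_le]
    intro q hq v hv
    have hv' : v ∈ maximalIdeal A ^ (r + k) := by
      rw [pow_add]; exact mul_mono_left hIr hv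
    obtain ⟨v₁', h₁, v₂', h₂, rfl⟩ := Submodule.mem_sup.1 (h.pow_add_le (hIr (hQI ha)) hu hau k hv')
    obtain ⟨v₁, hv₁, rfl⟩ := mem_span_singleton_mul.1 h₁
    obtain ⟨v₂, hv₂, rfl⟩ := mem_span_singleton_mul.1 h₂
    have hv₂I : v₂ ∈ I := h.mem_of_pow_mul_mem_mul hI hIr (hQI ha) hu hau (k := k)
      ((Submodule.add_mem_iff_right _ (mul_mem_mul (hQI ha) hv₁)).1 hv)
    rw [mul_add, mul_left_comm q, mul_left_comm q]
    exact Submodule.add_mem_sup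
      (mul_mem_mul (mem_span_singleton_self a) (mul_mem_mul (hQI hq) hv₁))
      (mul_mem_mul (mem_span_singleton_self _) (mul_mem_mul hq hv₂I))
  rw [mul_assoc] at ht
  obtain ⟨w', h₁, g', h₂, hsum⟩ := Submodule.mem_sup.1 (hle ht)
  obtain ⟨w, hw, rfl⟩ := mem_span_singleton_mul.1 h₁
  obtain ⟨g, hg, rfl⟩ := mem_span_singleton_mul.1 h₂
  have hd : x ^ k ∣ a * w := ⟨t - g, by linear_combination hsum⟩
  obtain ⟨w₁, rfl⟩ := h.prime.pow_dvd_of_dvd_mul_left k hxa hd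
  have hw₁ := h.mem_of_pow_mul_mem_mul hI hIr (hQI ha) hu hau hw
  have : t = a * w₁ + g := mul_left_cancel₀ (pow_ne_zero k h.prime.ne_zero)
    (by linear_combination -hsum)
  rw [this]
  exact add_mem (mul_mem_mul ha hw₁) hg

end IsRegularPair

variable {A S : Type*} [CommRing A] [CommRing S] [Algebra A S]

/-- `S` is the affine chart `A[y/x]` of the blow-up of the closed point, with `τ = y/x`. -/
structure IsQuadraticTransform (x y : A) (τ : S) : Prop where
  injective : Function.Injective (algebraMap A S)
  mul_eq : algebraMap A S x * τ = algebraMap A S y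
  adjoin_eq : Algebra.adjoin A {τ} = ⊤

namespace IsQuadraticTransform

variable {x y : A} {τ : S} (hS : IsQuadraticTransform x y τ)
include hS

lemma aeval_surjective : Function.Surjective (Polynomial.aeval (R := A) τ) := by
  rw [← AlgHom.range_eq_top, ← Algebra.adjoin_singleton_eq_range_aeval, hS.adjoin_eq]

lemma isNoetherianRing [IsNoetherianRing A] : IsNoetherianRing S :=
  isNoetherianRing_of_surjective _ _ (Polynomial.aeval (R := A) τ).toRingHom hS.aeval_surjective

variable [IsLocalRing A] (h : IsRegularPair x y)
include h

lemma map_maximalIdeal : (maximalIdeal A).map (algebraMap A S) = span {algebraMap A S x} := by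
  rw [h.span_eq, map_span, Set.image_pair, ← hS.mul_eq]
  refine le_antisymm (span_le.2 ?_) (span_mono (by simp))
  rintro z (rfl | rfl)
  · exact mem_span_singleton_self _
  · exact mul_mem_right _ _ (mem_span_singleton_self _)

lemma map_pow (k : ℕ) :
    (maximalIdeal A ^ k).map (algebraMap A S) = span {algebraMap A S x ^ k} := by
  rw [Ideal.map_pow, hS.map_maximalIdeal h, span_singleton_pow]

lemma exists_pow_mul_eq (s : S) :
    ∃ k, ∃ t ∈ maximalIdeal A ^ k, algebraMap A S x ^ k * s = algebraMap A S t := by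
  have hs : s ∈ Algebra.adjoin A {τ} := hS.adjoin_eq ▸ Algebra.mem_top
  induction hs using Algebra.adjoin_induction with
  | mem s hs =>
    obtain rfl := hs
    exact ⟨1, y, by simpa using h.right_mem, by rw [pow_one, hS.mul_eq]⟩
  | algebraMap a => exact ⟨0, a, by simp, by simp⟩
  | add s s' _ _ ih ih' =>
    obtain ⟨k, t, ht, hk⟩ := ih
    obtain ⟨l, u, hu, hl⟩ := ih'
    refine ⟨k + l, x ^ l * t + x ^ k * u, add_mem ?_ ?_, ?_⟩
    · rw [pow_add, mul_comm (x ^ l)]; exact mul_mem_mul ht (pow_mem_pow h.left_mem l)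
    · rw [pow_add]; exact mul_mem_mul (pow_mem_pow h.left_mem k) hu
    · simp only [map_add, map_mul, _root_.map_pow, ← hk, ← hl]; ring
  | mul s s' _ _ ih ih' =>
    obtain ⟨k, t, ht, hk⟩ := ih
    obtain ⟨l, u, hu, hl⟩ := ih'
    refine ⟨k + l, t * u, ?_, ?_⟩
    · rw [pow_add]; exact mul_mem_mul ht hu
    · simp only [map_mul, ← hk, ← hl]; ring

lemma exists_pow_mul_eq_of_mem_map {K : Ideal A} {s : S} (hs : s ∈ K.map (algebraMap A S)) :
    ∃ k, ∃ t ∈ K * maximalIdeal A ^ k, algebraMap A S x ^ k * s = algebraMap A S t := by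
  induction hs using Submodule.span_induction with
  | mem s hs =>
    obtain ⟨t, ht, rfl⟩ := hs
    exact ⟨0, t, by simpa using ht, by simp⟩
  | zero => exact ⟨0, 0, zero_mem _, by simp⟩
  | add s s' _ _ ih ih' =>
    obtain ⟨k, t, ht, hk⟩ := ih
    obtain ⟨l, u, hu, hl⟩ := ih'
    refine ⟨k + l, x ^ l * t + x ^ k * u, add_mem ?_ ?_, ?_⟩
    · rw [pow_add, mul_comm (x ^ l), ← mul_assoc]; exact mul_mem_mul ht (pow_mem_pow h.left_mem l)
    · rw [pow_add, mul_left_comm]; exact mul_mem_mul (pow_mem_pow h.left_mem k) hu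
    · simp only [map_add, map_mul, _root_.map_pow, ← hk, ← hl]; ring
  | smul c s _ ih =>
    obtain ⟨k, t, ht, hk⟩ := ih
    obtain ⟨l, u, hu, hl⟩ := hS.exists_pow_mul_eq h c
    refine ⟨k + l, t * u, ?_, ?_⟩
    · rw [pow_add, ← mul_assoc]; exact mul_mem_mul ht hu
    · simp only [map_mul, ← hk, ← hl, smul_eq_mul]; ring

lemma exists_pow_mul_mem {K : Ideal A} {z : A}
    (hz : algebraMap A S z ∈ K.map (algebraMap A S)) :
    ∃ k, x ^ k * z ∈ K * maximalIdeal A ^ k := by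
  obtain ⟨k, t, ht, hk⟩ := hS.exists_pow_mul_eq_of_mem_map h hz
  refine ⟨k, ?_⟩
  rw [← _root_.map_pow, ← map_mul] at hk
  rwa [hS.injective hk]

lemma exists_span_pow_mul_le {K L : Ideal A} (hK : K.FG)
    (hKL : K.map (algebraMap A S) ≤ L.map (algebraMap A S)) :
    ∃ k, span {x ^ k} * K ≤ L * maximalIdeal A ^ k := by
  induction K, hK using Submodule.fg_induction with
  | singleton z =>
    obtain ⟨k, hk⟩ := hS.exists_pow_mul_mem h (hKL (mem_map_of_mem _ (mem_span_singleton_self z)))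
    refine ⟨k, ?_⟩
    rw [submodule_span_eq, span_singleton_mul_span_singleton, span_singleton_le_iff_mem]
    exact hk
  | sup K K' _ _ ih ih' =>
    obtain ⟨k, hk⟩ := ih ((map_mono le_sup_left).trans hKL)
    obtain ⟨l, hl⟩ := ih' ((map_mono le_sup_right).trans hKL)
    refine ⟨k + l, ?_⟩
    have hx (i : ℕ) : span {x ^ i} ≤ maximalIdeal A ^ i :=
      (span_singleton_le_iff_mem _).2 (pow_mem_pow h.left_mem i)
    rw [Ideal.mul_sup, pow_add, ← span_singleton_mul_span_singleton, pow_add]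
    refine sup_le ?_ ?_
    · rw [mul_right_comm, ← mul_assoc]; exact mul_mono hk (hx l)
    · rw [mul_assoc, mul_left_comm L]; exact mul_mono (hx k) hl

lemma comap_aeval_span [IsDomain A] :
    (span {algebraMap A S x}).comap (Polynomial.aeval (R := A) τ) =
    (maximalIdeal A).map Polynomial.C := by
  refine le_antisymm (fun p hp => ?_) (map_le_iff_le_comap.2 fun a ha => ?_)
  · obtain ⟨s, hs⟩ := mem_span_singleton'.1 (mem_comap.1 hp)
    change _ = Polynomial.aeval τ p at hs
    obtain ⟨l, t, ht, hl⟩ := hS.exists_pow_mul_eq h s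
    obtain ⟨k, hk, hlk⟩ : ∃ k, p.natDegree ≤ k ∧ l ≤ k := ⟨_, le_max_left _ _, le_max_right _ _⟩
    obtain ⟨j, rfl⟩ := Nat.exists_eq_add_of_le hlk
    have hsum : ∑ i ∈ Finset.range (l + j + 1), p.coeff i * (x ^ (l + j - i) * y ^ i) =
        x ^ (j + 1) * t := by
      apply hS.injective
      have h1 : algebraMap A S (x ^ (j + 1) * t) =
          algebraMap A S x ^ (l + j) * Polynomial.aeval τ p := by
        rw [← hs, map_mul, ← hl, _root_.map_pow]; ring
      rw [h1, Polynomial.aeval_eq_sum_range' (Nat.lt_succ_of_le hk), map_sum, Finset.mul_sum]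
      refine Finset.sum_congr rfl fun i hi => ?_
      obtain ⟨c, hc⟩ := Nat.exists_eq_add_of_le (Finset.mem_range_succ_iff.1 hi)
      rw [hc, Nat.add_sub_cancel_left, Algebra.smul_def]
      simp only [map_mul, _root_.map_pow, ← hS.mul_eq]
      ring
    have hcoeff := h.coeff_mem_of_sum_mem (k := l + j) (p := p.coeff) (by
      rw [hsum, add_assoc, pow_add, mul_comm (x ^ (j + 1))]
      exact mul_mem_mul ht (pow_mem_pow h.left_mem _))
    rw [mem_map_C_iff]
    intro i
    by_cases hi : i ≤ l + j
    · exact hcoeff i hi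
    · rw [Polynomial.coeff_eq_zero_of_natDegree_lt (by omega)]; exact zero_mem _
  · rw [mem_comap, ← hS.map_maximalIdeal h, mem_comap]
    simpa using mem_map_of_mem (algebraMap A S) ha

lemma isPrime_span [IsDomain A] : (span {algebraMap A S x}).IsPrime := by
  have h1 : ((maximalIdeal A).map (Polynomial.C : A →+* Polynomial A)).IsPrime := inferInstance
  rw [← hS.comap_aeval_span h] at h1
  refine ⟨fun htop => h1.ne_top (by rw [htop, comap_top]), fun {a b} hab => ?_⟩
  obtain ⟨p, rfl⟩ := hS.aeval_surjective a
  obtain ⟨q, rfl⟩ := hS.aeval_surjective b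
  rw [← map_mul] at hab
  exact h1.mem_or_mem hab

lemma span_ne_of_isMaximal [IsDomain A] {N : Ideal S} (hN : N.IsMaximal) :
    span {algebraMap A S x} ≠ N := by
  rintro rfl
  have h1 := comap_isMaximal_of_surjective (Polynomial.aeval (R := A) τ) hS.aeval_surjective
    (K := span {algebraMap A S x})
  rw [hS.comap_aeval_span h] at h1
  obtain ⟨p, i, hi, hpi⟩ := h1.exists_inv (x := Polynomial.X) fun hX => by
    have := mem_map_C_iff.1 hX 1
    rw [Polynomial.coeff_X_one] at this
    exact (ne_top_iff_one _).1 (maximalIdeal.isMaximal A).ne_top this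
  have h2 := mem_map_C_iff.1 hi 0
  have h3 := congrArg (Polynomial.coeff · 0) hpi
  simp only [Polynomial.coeff_add, Polynomial.mul_coeff_zero, Polynomial.coeff_X_zero, mul_zero,
    zero_add, Polynomial.coeff_one_zero] at h3
  rw [h3] at h2
  exact (ne_top_iff_one _).1 (maximalIdeal.isMaximal A).ne_top h2

lemma exists_eq_span_pair [IsDomain A] {N : Ideal S} (hN : algebraMap A S x ∈ N) :
    ∃ g, N = span {algebraMap A S x, g} := by
  have hsurj : Function.Surjective (Polynomial.mapRingHom (residue A)) :=
    Polynomial.map_surjective (residue A) residue_surjective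
  have hker : RingHom.ker (Polynomial.mapRingHom (residue A)) =
      (maximalIdeal A).map Polynomial.C := by
    rw [Polynomial.ker_mapRingHom, ker_residue]
  obtain ⟨g', hg'⟩ := (IsPrincipalIdealRing.principal
    ((N.comap (Polynomial.aeval (R := A) τ)).map (Polynomial.mapRingHom (residue A)))).principal
  obtain ⟨g, rfl⟩ := hsurj g'
  rw [submodule_span_eq] at hg'
  have h1 := congrArg (comap (Polynomial.mapRingHom (residue A))) hg'
  have h2 : span {Polynomial.mapRingHom (residue A) g} =
      (span {g}).map (Polynomial.mapRingHom (residue A)) := by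
    rw [map_span, Set.image_singleton]
  have hle : (maximalIdeal A).map Polynomial.C ≤ N.comap (Polynomial.aeval (R := A) τ) := by
    rw [← hS.comap_aeval_span h]
    exact comap_mono ((span_singleton_le_iff_mem _).2 hN)
  rw [h2, comap_map_of_surjective' _ hsurj, comap_map_of_surjective' _ hsurj, hker,
    sup_eq_left.2 hle] at h1
  refine ⟨Polynomial.aeval τ g, ?_⟩
  rw [← map_comap_of_surjective _ hS.aeval_surjective N, h1, Ideal.map_sup, map_span,
    Set.image_singleton, ← hS.comap_aeval_span h, map_comap_of_surjective _ hS.aeval_surjective,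
    sup_comm, ← span_union]
  rfl

variable {L : Type*} [CommRing L] [Algebra S L]

lemma exists_maximalIdeal_eq_span_pair [IsDomain A] {N : Ideal S} [N.IsPrime]
    [IsLocalization.AtPrime L N] [IsLocalRing L] (hN : algebraMap A S x ∈ N) :
    ∃ a b : L, maximalIdeal L = span {a, b} := by
  obtain ⟨g, hg⟩ := hS.exists_eq_span_pair h hN
  refine ⟨algebraMap S L (algebraMap A S x), algebraMap S L g, ?_⟩
  rw [← IsLocalization.AtPrime.map_eq_maximalIdeal N L, hg, map_span, Set.image_pair]

lemma one_lt_height [IsDomain A] [IsDomain S] {N : Ideal S} [hmax : N.IsMaximal]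
    [IsLocalization.AtPrime L N] [IsLocalRing L] (hN : algebraMap A S x ∈ N) :
    1 < (maximalIdeal L).height := by
  have h1 : (maximalIdeal L).height = N.height := by
    have := maximalIdeal_height_eq_ringKrullDim (R := L)
    rw [IsLocalization.AtPrime.ringKrullDim_eq_height N L] at this
    exact_mod_cast this
  have hprime := hS.isPrime_span h
  have hx : algebraMap A S x ≠ 0 := (map_ne_zero_iff _ hS.injective).2 h.prime.ne_zero
  have hbot : (⊥ : Ideal S) < span {algebraMap A S x} :=
    bot_lt_iff_ne_bot.2 (by rwa [Ne, span_singleton_eq_bot])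
  have hlt : span {algebraMap A S x} < N :=
    lt_of_le_of_ne ((span_singleton_le_iff_mem _).2 hN) (hS.span_ne_of_isMaximal h hmax)
  have := isPrime_bot (α := S)
  have h2 := height_add_one_le_of_lt_of_isPrime hbot
  have h3 := height_add_one_le_of_lt_of_isPrime hlt
  have h4 : (1 : ℕ∞) + 1 ≤ N.height :=
    le_trans (by gcongr; exact le_trans (by simp) h2) h3
  rw [h1]
  exact lt_of_lt_of_le (by norm_num) h4

lemma infinite_residueField [Infinite (ResidueField A)] {N : Ideal S} [hmax : N.IsMaximal]
    [IsLocalization.AtPrime L N] [IsLocalRing L] (hN : algebraMap A S x ∈ N) :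
    Infinite (ResidueField L) := by
  have hle : maximalIdeal A ≤ (maximalIdeal L).comap ((algebraMap S L).comp (algebraMap A S)) := by
    rw [← comap_comap, ← map_le_iff_le_comap, hS.map_maximalIdeal h, ← under_def,
      IsLocalization.AtPrime.under_maximalIdeal L N, span_singleton_le_iff_mem]
    exact hN
  let f : ResidueField A →+* ResidueField L := Ideal.quotientMap (maximalIdeal L) _ hle
  exact Infinite.of_injective f f.injective

end IsQuadraticTransform

lemma exists_isQuadraticTransform {A : Type*} [CommRing A] [IsDomain A] {x : A} (hx : x ≠ 0)
    (y : A) :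
    ∃ (S : Subalgebra A (FractionRing A)) (τ : S), IsQuadraticTransform x y τ := by
  refine ⟨Algebra.adjoin A
    {algebraMap A (FractionRing A) y / algebraMap A (FractionRing A) x},
    ⟨_, Algebra.self_mem_adjoin_singleton A _⟩, FaithfulSMul.algebraMap_injective _ _,
    Subtype.ext ?_, ?_⟩
  · exact mul_div_cancel₀ _ ((map_ne_zero_iff _ (FaithfulSMul.algebraMap_injective _ _)).2 hx)
  · rw [← Algebra.adjoin_adjoin_coe_preimage]
    congr 1
    ext z
    simp [Subtype.ext_iff]

end IsLocalRing

namespace Ideal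

lemma length_quotient_add_one_le {A L : Type*} [CommRing A] [CommRing L] {I : Ideal A}
    {J : Ideal L} (Φ : Ideal L → Ideal A) (hle : ∀ K, J ≤ K → I ≤ Φ K) (htop : ∀ K, Φ K ≠ ⊤)
    (hmono : Monotone Φ) (hrefl : ∀ K K', J ≤ K → J ≤ K' → Φ K ≤ Φ K' → K ≤ K') :
    Module.length L (L ⧸ J) + 1 ≤ Module.length A (A ⧸ I) := by
  have h1 : Order.krullDim (WithTop (Set.Ici J)) ≤ Order.krullDim (Set.Ici I) := by
    refine Order.krullDim_le_of_strictMono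
      (fun K => K.recTopCoe ⟨⊤, Set.mem_Ici.2 le_top⟩ fun K => ⟨Φ K, hle K K.2⟩) ?_
    intro K K' hlt
    induction K' using WithTop.recTopCoe with
    | top =>
      induction K using WithTop.recTopCoe with
      | top => exact absurd hlt (lt_irrefl _)
      | coe K => exact (htop K).lt_top
    | coe K' =>
      induction K using WithTop.recTopCoe with
      | top => exact absurd hlt not_top_lt
      | coe K =>
        have hlt' : K < K' := WithTop.coe_lt_coe.1 hlt
        exact lt_of_le_not_ge (hmono hlt'.le) fun hge => hlt'.not_ge (hrefl _ _ K'.2 K.2 hge)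
  have : Nonempty (Set.Ici J) := ⟨⟨J, Set.mem_Ici.2 le_rfl⟩⟩
  rw [Order.krullDim_WithTop, ← Order.krullDim_eq_of_orderIso (Submodule.comapMkQRelIso J),
    ← Order.krullDim_eq_of_orderIso (Submodule.comapMkQRelIso I), ← Module.coe_length,
    ← Module.coe_length] at h1
  exact_mod_cast h1

lemma exists_span_mul_le_of_map_le {S L : Type*} [CommRing S] [CommRing L] [Algebra S L]
    (W : Submonoid S) [IsLocalization W L] {K K' : Ideal S} (hK : K.FG)
    (hle : K.map (algebraMap S L) ≤ K'.map (algebraMap S L)) :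
    ∃ w ∈ W, span {w} * K ≤ K' := by
  induction K, hK using Submodule.fg_induction with
  | singleton z =>
    obtain ⟨w, hw, hwz⟩ := (IsLocalization.algebraMap_mem_map_algebraMap_iff W L K' z).1
      (hle (mem_map_of_mem _ (mem_span_singleton_self z)))
    refine ⟨w, hw, ?_⟩
    rw [submodule_span_eq, span_singleton_mul_span_singleton, span_singleton_le_iff_mem]
    exact hwz
  | sup K₁ K₂ _ _ ih₁ ih₂ =>
    obtain ⟨w₁, hw₁, h₁⟩ := ih₁ ((map_mono le_sup_left).trans hle)
    obtain ⟨w₂, hw₂, h₂⟩ := ih₂ ((map_mono le_sup_right).trans hle)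
    refine ⟨w₁ * w₂, mul_mem hw₁ hw₂, ?_⟩
    rw [Ideal.mul_sup, ← span_singleton_mul_span_singleton]
    refine sup_le ?_ ?_
    · rw [mul_right_comm]; exact mul_le_left.trans h₁
    · rw [mul_assoc]; exact mul_le_right.trans h₂

/-- If the length of `A ⧸ I` is finite, then `I` contains a power of each element of the maximal
ideal. -/
lemma exists_pow_mem_of_length_ne_top {A : Type*} [CommRing A] [IsLocalRing A] {I : Ideal A}
    (h : Module.length A (A ⧸ I) ≠ ⊤) {x : A} (hx : x ∈ maximalIdeal A) : ∃ n, x ^ n ∈ I := by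
  have := (isFiniteLength_iff_isNoetherian_isArtinian.1 (Module.length_ne_top_iff.1 h)).2
  obtain ⟨n, y, hy⟩ := IsArtinian.exists_pow_succ_smul_dvd x (1 : A ⧸ I)
  obtain ⟨y, rfl⟩ := Ideal.Quotient.mk_surjective y
  refine ⟨n, ?_⟩
  have h1 : x ^ n * (1 - x * y) ∈ I := by
    rw [← neg_mem_iff, ← Ideal.Quotient.eq_zero_iff_mem]
    have : -(x ^ n * (1 - x * y)) = x ^ n.succ * y - x ^ n * 1 := by
      rw [Nat.succ_eq_add_one]; ring
    rw [this, map_sub, sub_eq_zero]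
    exact hy
  have hu : IsUnit (1 - x * y) := by
    by_contra hn
    have := add_mem ((mem_maximalIdeal _).2 hn) (mul_mem_right y _ hx)
    rw [sub_add_cancel] at this
    exact (ne_top_iff_one _).1 (maximalIdeal.isMaximal A).ne_top this
  exact (mul_unit_mem_iff_mem I hu).1 h1

end Ideal

namespace IsLocalRing

open Ideal

namespace IsQuadraticTransform

variable {A S : Type*} [CommRing A] [IsLocalRing A] [CommRing S] [Algebra A S] {x y : A}
  {τ : S} (hS : IsQuadraticTransform x y τ) (h : IsRegularPair x y) {r : ℕ} {I : Ideal A} {a u : A}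
include hS h

/-- Up to a power of `x`, every ideal of the quadratic transform is extended. -/
lemma exists_span_mul_eq_map {K : Ideal S} (hK : K.FG) :
    ∃ (k : ℕ) (M : Ideal A), span {algebraMap A S x ^ k} * K = M.map (algebraMap A S) := by
  induction K, hK using Submodule.fg_induction with
  | singleton s =>
    obtain ⟨k, t, -, hk⟩ := hS.exists_pow_mul_eq h s
    refine ⟨k, span {t}, ?_⟩
    rw [submodule_span_eq, span_singleton_mul_span_singleton, hk, map_span, Set.image_singleton]
  | sup K K' _ _ ih ih' =>
    obtain ⟨k, M, hM⟩ := ih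
    obtain ⟨l, M', hM'⟩ := ih'
    refine ⟨k + l, span {x ^ l} * M ⊔ span {x ^ k} * M', ?_⟩
    rw [Ideal.map_sup, Ideal.map_mul, Ideal.map_mul, ← hM, ← hM', map_span, map_span,
      Set.image_singleton, Set.image_singleton, Ideal.mul_sup, pow_add,
      ← span_singleton_mul_span_singleton, _root_.map_pow, _root_.map_pow]
    congr 1 <;> ring

variable [IsDomain A] [IsDomain S]

/-- `x ^ r S = 𝔪 ^ r S` is contained in `I S + 𝔪 ^ r`. -/
lemma exists_pow_mul_eq_add (ha : a ∈ I) (har : a ∈ maximalIdeal A ^ r) (hu : IsUnit u)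
    (hau : x ∣ a - u * y ^ r) (s : S) :
    ∃ t ∈ maximalIdeal A ^ r, ∃ i ∈ I.map (algebraMap A S),
      algebraMap A S x ^ r * s = algebraMap A S t + i := by
  obtain ⟨k, t₀, ht₀, hk⟩ := hS.exists_pow_mul_eq h s
  have h1 : x ^ r * t₀ ∈ maximalIdeal A ^ (r + k) := by
    rw [pow_add]; exact mul_mem_mul (pow_mem_pow h.left_mem r) ht₀
  obtain ⟨v₁, h₁, v₂, h₂, hsum⟩ := Submodule.mem_sup.1 (h.pow_add_le har hu hau k h1)
  obtain ⟨v, hv, rfl⟩ := mem_span_singleton_mul.1 h₁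
  obtain ⟨t, ht, rfl⟩ := mem_span_singleton_mul.1 h₂
  have h3 := mem_map_of_mem (algebraMap A S) hv
  rw [hS.map_pow h, mem_span_singleton] at h3
  obtain ⟨v', hv'⟩ := h3
  refine ⟨t, ht, algebraMap A S a * v', mul_mem_right _ _ (mem_map_of_mem _ ha), ?_⟩
  have hx : algebraMap A S x ≠ 0 := (map_ne_zero_iff _ hS.injective).2 h.prime.ne_zero
  refine mul_left_cancel₀ (pow_ne_zero k hx) ?_
  have h4 := congrArg (algebraMap A S) hsum
  simp only [map_add, map_mul, _root_.map_pow, hv', ← hk] at h4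
  linear_combination -h4

lemma mem_of_span_mul_le [IsNoetherianRing A] (hI : I.IsMulClosed) (hIr : I ≤ maximalIdeal A ^ r)
    (ha : a ∈ I) (hu : IsUnit u) (hau : x ∣ a - u * y ^ r) {t : A} (ht : t ∈ maximalIdeal A ^ r)
    {K : Ideal S} (hK : K ≠ ⊥)
    (hle : span {algebraMap A S t} * K ≤ I.map (algebraMap A S) * K) : t ∈ I := by
  have := hS.isNoetherianRing
  have hx : algebraMap A S x ≠ 0 := (map_ne_zero_iff _ hS.injective).2 h.prime.ne_zero
  obtain ⟨l, M, hM⟩ := hS.exists_span_mul_eq_map h (IsNoetherian.noetherian K)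
  have hM0 : M ≠ ⊥ := by
    rintro rfl
    rw [Ideal.map_bot] at hM
    refine mul_ne_zero ?_ hK hM
    rw [Ne, zero_eq_bot, span_singleton_eq_bot]
    exact pow_ne_zero l hx
  obtain ⟨k, hk⟩ := hS.exists_span_pow_mul_le h (K := span {t} * M) (L := I * M)
    (IsNoetherian.noetherian _) (by
      rw [Ideal.map_mul, Ideal.map_mul, ← hM, map_span, Set.image_singleton, mul_left_comm,
        mul_left_comm (map _ _)]
      exact mul_mono_right hle)
  rw [mul_right_comm] at hk
  exact h.mem_of_mul_le hI hIr ha hu hau ht hM0 hk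

variable {I' : Ideal S} (hI' : span {algebraMap A S x ^ r} * I' = I.map (algebraMap A S))
include hI'

/-- The strict transform of an integrally closed ideal is integrally closed. -/
lemma isMulClosed_map {L : Type*} [CommRing L] [Algebra S L] (W : Submonoid S)
    [IsLocalization W L] [IsNoetherianRing A] (hI : I.IsMulClosed) (hIr : I ≤ maximalIdeal A ^ r)
    (ha : a ∈ I) (hu : IsUnit u) (hau : x ∣ a - u * y ^ r) :
    (I'.map (algebraMap S L)).IsMulClosed := by
  have := hS.isNoetherianRing
  have hx : algebraMap A S x ≠ 0 := (map_ne_zero_iff _ hS.injective).2 h.prime.ne_zero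
  intro z M hM hz
  obtain ⟨⟨s, w⟩, hs⟩ := IsLocalization.surj W z
  have hw := IsLocalization.map_units L w
  rw [← IsLocalization.map_under W L M] at hz
  have hM0 : M.under S ≠ ⊥ := fun h0 => hM (by
    rw [← IsLocalization.map_under W L M, h0, Ideal.map_bot])
  obtain ⟨w', hw', hle⟩ := exists_span_mul_le_of_map_le (L := L) W (K := span {s} * M.under S)
    (K' := I' * M.under S) (IsNoetherian.noetherian _) (by
      rw [Ideal.map_mul, Ideal.map_mul, map_span, Set.image_singleton]
      refine le_trans (mul_mono_left ?_) hz
      rw [← hs, span_singleton_le_span_singleton]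
      exact Dvd.intro _ rfl)
  obtain ⟨t, ht, i, hi, hti⟩ := hS.exists_pow_mul_eq_add h ha (hIr ha) hu hau (w' * s)
  have htI : t ∈ I := hS.mem_of_span_mul_le h hI hIr ha hu hau ht hM0 (by
    rw [span_singleton_mul_le_iff]
    intro c hc
    have h1 : algebraMap A S t * c =
        algebraMap A S x ^ r * (w' * (s * c)) - i * c := by
      linear_combination -c * hti
    rw [h1]
    refine sub_mem ?_ (mul_mem_mul hi hc)
    rw [← hI', mul_assoc]
    exact mul_mem_mul (mem_span_singleton_self _) (hle (mul_mem_mul (mem_span_singleton_self _)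
      (mul_mem_mul (mem_span_singleton_self _) hc))))
  have h2 : w' * s ∈ I' := by
    have h3 : algebraMap A S x ^ r * (w' * s) ∈ span {algebraMap A S x ^ r} * I' := by
      rw [hI', hti]
      exact add_mem (mem_map_of_mem _ htI) hi
    obtain ⟨c, hc, hcs⟩ := mem_span_singleton_mul.1 h3
    rwa [← mul_left_cancel₀ (pow_ne_zero r hx) hcs]
  have h4 := mem_map_of_mem (algebraMap S L) h2
  rw [map_mul, ← hs, unit_mul_mem_iff_mem _ (IsLocalization.map_units L ⟨w', hw'⟩),
    mul_unit_mem_iff_mem _ hw] at h4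
  exact h4

/-- Passing to the strict transform lowers the colength. -/
lemma length_quotient_map_add_one_le {L : Type*} [CommRing L] [Algebra S L]
    (W : Submonoid S) [IsLocalization W L] (hIr : I ≤ maximalIdeal A ^ r) (hr : r ≠ 0)
    (ha : a ∈ I) (hu : IsUnit u) (hau : x ∣ a - u * y ^ r) :
    Module.length L (L ⧸ I'.map (algebraMap S L)) + 1 ≤ Module.length A (A ⧸ I) := by
  have hx : algebraMap A S x ≠ 0 := (map_ne_zero_iff _ hS.injective).2 h.prime.ne_zero
  have hxr := pow_ne_zero r hx
  let Φ (K : Ideal L) : Ideal A :=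
    { carrier := {t | t ∈ maximalIdeal A ^ r ∧ ∃ s, algebraMap A S t = algebraMap A S x ^ r * s ∧
        algebraMap S L s ∈ K}
      zero_mem' := ⟨zero_mem _, 0, by simp, by simp⟩
      add_mem' := by
        rintro t t' ⟨ht, s, hs, hsK⟩ ⟨ht', s', hs', hsK'⟩
        exact ⟨add_mem ht ht', s + s', by rw [map_add, hs, hs', mul_add],
          by rw [map_add]; exact add_mem hsK hsK'⟩
      smul_mem' := by
        rintro c t ⟨ht, s, hs, hsK⟩
        exact ⟨mul_mem_left _ _ ht, algebraMap A S c * s,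
          by rw [smul_eq_mul, map_mul, hs, mul_left_comm],
          by rw [map_mul]; exact mul_mem_left _ _ hsK⟩ }
  refine length_quotient_add_one_le Φ (fun K hK t ht => ⟨hIr ht, ?_⟩) (fun K htop => ?_)
    (fun K K' hKK' t ht => ?_) (fun K K' hK hK' hle z hz => ?_)
  · have h1 := mem_map_of_mem (algebraMap A S) ht
    rw [← hI'] at h1
    obtain ⟨s, hs, hst⟩ := mem_span_singleton_mul.1 h1
    exact ⟨s, hst.symm, hK (mem_map_of_mem _ hs)⟩
  · have h1 : (1 : A) ∈ Φ K := htop ▸ Submodule.mem_top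
    exact (ne_top_iff_one _).1 (maximalIdeal.isMaximal A).ne_top (pow_le_self hr h1.1)
  · obtain ⟨h1, s, hs, hsK⟩ := ht
    exact ⟨h1, s, hs, hKK' hsK⟩
  · obtain ⟨⟨s, w⟩, hs⟩ := IsLocalization.surj W z
    have hw := IsLocalization.map_units L w
    rw [← mul_unit_mem_iff_mem _ hw, hs] at hz ⊢
    obtain ⟨t, ht, i, hi, hti⟩ := hS.exists_pow_mul_eq_add h ha (hIr ha) hu hau s
    rw [← hI'] at hi
    obtain ⟨i', hi', rfl⟩ := mem_span_singleton_mul.1 hi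
    have hsi : algebraMap A S t = algebraMap A S x ^ r * (s - i') := by
      linear_combination -hti
    have hi'L := mem_map_of_mem (algebraMap S L) hi'
    obtain ⟨-, s', hs', hs'K⟩ := hle (show t ∈ Φ K from
      ⟨ht, s - i', hsi, by rw [map_sub]; exact sub_mem hz (hK hi'L)⟩)
    have heq : s - i' = s' := mul_left_cancel₀ hxr (hsi.symm.trans hs')
    rw [← heq, map_sub] at hs'K
    exact (Submodule.sub_mem_iff_left _ (hK' hi'L)).1 hs'K

end IsQuadraticTransform

universe v

lemma IsQuadraticTransform.mul_self_le_mul {A S : Type v} [CommRing A] [IsLocalRing A] [IsDomain A]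
    [IsNoetherianRing A] [Infinite (ResidueField A)] [CommRing S] [IsDomain S] [Algebra A S]
    {x y : A} {τ : S} (hS : IsQuadraticTransform x y τ) (h : IsRegularPair x y) {n : ℕ}
    (ih : ∀ (L : Type v) [CommRing L] [IsLocalRing L] [IsDomain L] [IsNoetherianRing L]
      [Infinite (ResidueField L)], (∃ x y : L, maximalIdeal L = span {x, y}) →
      1 < (maximalIdeal L).height → ∀ I Q M : Ideal L, Module.length L (L ⧸ I) ≤ n →
      I.IsMulClosed → Q ≤ I → M ≠ ⊥ → I * M ≤ Q * M → I * I ≤ Q * I)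
    {r : ℕ} (hr0 : r ≠ 0) {I Q M : Ideal A} (hlen : Module.length A (A ⧸ I) ≤ (n + 1 : ℕ))
    (hI : I.IsMulClosed) (hIr : I ≤ maximalIdeal A ^ r) (hQI : Q ≤ I) (hM : M ≠ ⊥)
    (hIM : I * M ≤ Q * M) {a u : A} (ha : a ∈ Q) (hu : IsUnit u) (hau : x ∣ a - u * y ^ r) :
    I * I ≤ Q * I := by
  have := hS.isNoetherianRing
  have hx : algebraMap A S x ≠ 0 := (map_ne_zero_iff _ hS.injective).2 h.prime.ne_zero
  have hxr := pow_ne_zero r hx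
  obtain ⟨I', hI'⟩ := exists_span_singleton_mul_eq ((map_mono hIr).trans (hS.map_pow h r).le)
  obtain ⟨Q', hQ'⟩ := exists_span_singleton_mul_eq
    ((map_mono (hQI.trans hIr)).trans (hS.map_pow h r).le)
  have hQI' : Q' ≤ I' := by
    rw [← span_singleton_mul_right_mono hxr, hI', hQ']
    exact map_mono hQI
  have hIM' : I' * M.map (algebraMap A S) ≤ Q' * M.map (algebraMap A S) := by
    rw [← span_singleton_mul_right_mono hxr, ← mul_assoc, ← mul_assoc, hI', hQ',
      ← Ideal.map_mul, ← Ideal.map_mul]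
    exact map_mono hIM
  have hle : I' * I' ≤ Q' * I' := by
    refine le_of_localization_maximal fun N hN => ?_
    have : IsDomain (Localization.AtPrime N) :=
      IsLocalization.isDomain_localization N.primeCompl_le_nonZeroDivisors
    have hML : (M.map (algebraMap A S)).map (algebraMap S (Localization.AtPrime N)) ≠ ⊥ := by
      rw [Ne, map_eq_bot_iff_of_injective
        (IsLocalization.injective _ N.primeCompl_le_nonZeroDivisors),
        map_eq_bot_iff_of_injective hS.injective]
      exact hM
    have hIML := map_mono (f := algebraMap S (Localization.AtPrime N)) hIM'
    rw [Ideal.map_mul, Ideal.map_mul] at hIML ⊢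
    by_cases hIN : I' ≤ N
    · have hxN : algebraMap A S x ∈ N := by
        obtain ⟨m, hm⟩ := exists_pow_mem_of_length_ne_top
          (ne_top_of_le_ne_top (ENat.natCast_ne_top _) hlen) h.left_mem
        refine hN.isPrime.mem_of_pow_mem m ?_
        rw [← _root_.map_pow]
        have hle : I.map (algebraMap A S) ≤ I' := hI'.symm.trans_le mul_le_right
        exact hIN (hle (mem_map_of_mem _ hm))
      have := hS.infinite_residueField h (L := Localization.AtPrime N) hxN
      refine ih _ (hS.exists_maximalIdeal_eq_span_pair h hxN) (hS.one_lt_height h hxN) _ _ _ ?_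
        (hS.isMulClosed_map h hI' N.primeCompl hI hIr (hQI ha) hu hau) (map_mono hQI') hML hIML
      have := (hS.length_quotient_map_add_one_le h hI' (L := Localization.AtPrime N)
        N.primeCompl hIr hr0 (hQI ha) hu hau).trans hlen
      rw [Nat.cast_add, Nat.cast_one] at this
      exact (ENat.add_le_add_iff_right ENat.one_ne_top).1 this
    · have htop' : I'.map (algebraMap S (Localization.AtPrime N)) = ⊤ := by
        obtain ⟨s, hs, hsN⟩ := SetLike.not_le_iff_exists.1 hIN
        exact eq_top_of_isUnit_mem _ (mem_map_of_mem _ hs)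
          (IsLocalization.map_units (M := N.primeCompl) _ ⟨s, hsN⟩)
      rw [htop'] at hIML ⊢
      rw [eq_top_of_top_mul_le hML hIML]
  intro t ht'
  obtain ⟨k, hk⟩ := hS.exists_pow_mul_mem h (K := Q * I) (z := t) (by
    have h1 := mem_map_of_mem (algebraMap A S) ht'
    rw [Ideal.map_mul, ← hI', mul_mul_mul_comm] at h1
    rw [Ideal.map_mul, ← hI', ← hQ', mul_mul_mul_comm]
    exact mul_mono_right hle h1)
  exact h.mem_mul_of_pow_mul_mem_mul hI hIr hQI ha hu hau hk

/-- Integrally closed ideals of finite colength in a two-dimensional regular local ring have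
reduction number at most one. -/
theorem mul_self_le_mul_of_isMulClosed (n : ℕ) : ∀ (A : Type v) [CommRing A] [IsLocalRing A]
    [IsDomain A] [IsNoetherianRing A] [Infinite (ResidueField A)],
    (∃ x y : A, maximalIdeal A = span {x, y}) → 1 < (maximalIdeal A).height →
    ∀ I Q M : Ideal A, Module.length A (A ⧸ I) ≤ n → I.IsMulClosed → Q ≤ I → M ≠ ⊥ →
    I * M ≤ Q * M → I * I ≤ Q * I := by
  induction n with
  | zero =>
    intro A _ _ _ _ _ _ _ I Q M hlen _ _ hM hIM
    have h0 := Module.length_eq_zero_iff.1 (le_antisymm hlen bot_le)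
    obtain rfl : I = ⊤ := Ideal.Quotient.subsingleton_iff.1 h0
    rw [eq_top_of_top_mul_le hM hIM]
  | succ n ih =>
    rintro A _ _ _ _ _ ⟨x₀, y, hxy⟩ ht I Q M hlen hI hQI hM hIM
    classical
    by_cases htop : I = ⊤
    · rw [htop] at hIM
      rw [eq_top_of_top_mul_le hM hIM]
      exact mul_mono_left le_top
    by_cases hbot : I = ⊥
    · simp [hbot]
    have hex : ∃ r, ¬ I ≤ maximalIdeal A ^ r := by
      by_contra! h
      refine hbot (le_bot_iff.1 ?_)
      rw [← iInf_pow_eq_bot_of_isDomain (maximalIdeal A) (maximalIdeal.isMaximal A).ne_top]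
      exact le_iInf h
    obtain ⟨r, hr⟩ : ∃ r, Nat.find hex = r + 1 := Nat.exists_eq_succ_of_ne_zero fun h => by
      have := Nat.find_spec hex
      simp [h] at this
    have hIr : I ≤ maximalIdeal A ^ r := not_not.1 (Nat.find_min hex (by omega))
    have hIr' : ¬ I ≤ maximalIdeal A ^ (r + 1) := hr ▸ Nat.find_spec hex
    have hr0 : r ≠ 0 := by
      rintro rfl
      exact hIr' (by simpa using le_maximalIdeal htop)
    obtain ⟨f, hf, hf'⟩ := SetLike.not_le_iff_exists.1 hIr'
    obtain ⟨c, u, hu, hfu⟩ := (IsRegularPair.of_height hxy ht).exists_general (hIr hf) hf'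
    have hgen : maximalIdeal A = span {x₀ - c * y, y} := by
      rw [hxy, sub_eq_add_neg, ← neg_mul]
      exact (span_pair_add_mul_right _ _ _).symm
    have h := IsRegularPair.of_height hgen ht
    obtain ⟨a, ha, b, hb, rfl⟩ := Submodule.mem_sup.1 (h.le_sup_of_mul_le hM hIM hf)
    have hau : x₀ - c * y ∣ a - u * y ^ r := by
      have := dvd_sub hfu (mem_span_singleton.1 hb)
      rwa [add_sub_right_comm, add_sub_cancel_right] at this
    generalize x₀ - c * y = x at h hau
    clear hfu hgen hb
    obtain ⟨S, τ, hS⟩ := exists_isQuadraticTransform h.prime.ne_zero y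
    exact hS.mul_self_le_mul h ih hr0 hlen hI hIr hQI hM hIM ha hu hau

lemma length_quotient_ne_top_of_radical_eq {A : Type*} [CommRing A] [IsLocalRing A]
    [IsNoetherianRing A] {I : Ideal A} (hI : I.radical = maximalIdeal A) :
    Module.length A (A ⧸ I) ≠ ⊤ := by
  have : IsArtinianRing (A ⧸ I) := quotient_artinian_of_mem_minimalPrimes_of_isLocalRing I (by
    rw [← Ideal.radical_minimalPrimes, hI, Ideal.minimalPrimes_eq_subsingleton_self]
    exact Set.mem_singleton _)
  rw [Module.length_ne_top_iff, isFiniteLength_iff_isNoetherian_isArtinian]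
  exact ⟨isNoetherian_quotient I,
    isArtinian_of_surjective_algebraMap (Ideal.Quotient.mk_surjective (I := I))⟩

end IsLocalRing

/-- **Corollary 3.2.**  Let `(A, 𝔪)` be a two-dimensional regular local ring with
infinite residue field, `I` an `𝔪`-primary ideal and `Q` a minimal reduction of `I`.
Then `r_Q(I) ≤ μ_A(Ī/I) + 1`, where `Ī` is the integral closure of `I` and
`μ_A(Ī/I)` is the least cardinality of a finite set `s` with `Ī = I + span s`. -/
theorem reduction_number_le_mu_integralClosure {A : Type*} [CommRing A]
    [IsNoetherianRing A] [IsLocalRing A]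
    (hdim : ringKrullDim A = 2)
    (hreg : ∃ s : Finset A, Ideal.span (↑s : Set A) = maximalIdeal A ∧
      (s.card : WithBot ℕ∞) = ringKrullDim A)
    (hres : Infinite (ResidueField A))
    (I Q : Ideal A) (hprim : I.IsPrimary) (hrad : I.radical = maximalIdeal A)
    (hQ : IsMinimalReduction Q I) :
    redNum Q I ≤
      ((sInf {m : ℕ | ∃ s : Finset A, s.card = m ∧
        ((I + Ideal.span (↑s : Set A) : Ideal A) : Set A) = idealIC I} + 1 : ℕ) : ℕ∞) := by
  have hht := maximalIdeal_height_eq_ringKrullDim (R := A)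
  rw [hdim] at hht
  have hht2 : (maximalIdeal A).height = 2 := WithBot.coe_injective hht
  have ht : 1 < (maximalIdeal A).height := by rw [hht2]; exact Nat.one_lt_ofNat
  obtain ⟨x, y, hxy⟩ : ∃ x y : A, maximalIdeal A = Ideal.span {x, y} := by
    classical
    obtain ⟨s, hs, hcard⟩ := hreg
    rw [hdim] at hcard
    obtain ⟨x, y, -, rfl⟩ := Finset.card_eq_two.1 (show s.card = 2 by exact_mod_cast hcard)
    exact ⟨x, y, by rw [← hs]; simp⟩
  have := isDomain_of_height hxy ht
  have hI0 : I ≠ ⊥ := by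
    rintro rfl
    rw [(Ideal.isPrime_bot (α := A)).isRadical.radical] at hrad
    rw [← hrad, Ideal.height_bot] at ht
    exact not_lt_bot ht
  obtain ⟨⟨hQI, n, hn⟩, -⟩ := hQ
  obtain ⟨M, hM, hJM⟩ := I.exists_mulClosure_mul_le
  have hle := I.le_mulClosure
  have hlen : Module.length A (A ⧸ I.mulClosure) ≠ ⊤ := by
    have hI : Module.length A (A ⧸ I) ≠ ⊤ := length_quotient_ne_top_of_radical_eq hrad
    exact ne_top_of_le_ne_top hI (Module.length_le_of_surjective (Submodule.factor hle)
      (Submodule.factor_surjective hle))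
  obtain ⟨d, hd⟩ := ENat.ne_top_iff_exists.1 hlen
  have hJ : I.mulClosure * I.mulClosure ≤ Q * I.mulClosure :=
    mul_self_le_mul_of_isMulClosed d A ⟨x, y, hxy⟩ ht _ _ (M * I ^ n) hd.ge
      I.isMulClosed_mulClosure (hQI.trans hle) (mul_ne_zero hM (pow_ne_zero n hI0)) (by
        rw [← mul_assoc]
        refine (Ideal.mul_mono_left hJM).trans_eq ?_
        rw [mul_right_comm, ← pow_succ', hn, mul_assoc, mul_comm (I ^ n)])
  set T := {m : ℕ | ∃ s : Finset A, s.card = m ∧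
        ((I + Ideal.span (↑s : Set A) : Ideal A) : Set A) = idealIC I}
  have hT : T.Nonempty := by
    obtain ⟨s, hs⟩ := IsNoetherian.noetherian I.mulClosure
    refine ⟨_, s, rfl, ?_⟩
    rw [← Ideal.coe_mulClosure hI0, Submodule.add_eq_sup, Ideal.span, hs, sup_eq_right.2 hle]
  obtain ⟨s, hcard, hs⟩ := Nat.sInf_mem hT
  rw [← hcard]
  rw [← Ideal.coe_mulClosure hI0] at hs
  refine sInf_le ⟨s.card + 1, rfl, le_antisymm
    (Ideal.pow_card_add_two_le hQI hJ s (SetLike.coe_injective hs).symm) ?_⟩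
  rw [pow_succ' I (s.card + 1)]
  exact Ideal.mul_mono_left hQI
end
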